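/- Let n ≥ 2 be even and let f : Sⁿ → ℝPⁿ be a continuous map into real projective n-space. Then the pair (f,f) is loose if and only if f is nullhomotopic (homotopic to a constant map). -/

import Mathlib

open scoped Manifold Topology

/-- The unit sphere `S^m ⊆ ℝ^{m+1}`, as a topological space. -/
abbrev UnitSphere (m : ℕ) : Type :=
  Metric.sphere (0 : EuclideanSpace ℝ (Fin (m + 1))) 1

/-- A pair `(f₁, f₂)` of continuous maps is *loose* if `f₁` and `f₂` can be deformed
(by free homotopies) to maps `f₁'`, `f₂'` without any coincidence point. -/
def Loose {X N : Type*} [TopologicalSpace X] [TopologicalSpace N]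
    (f₁ f₂ : C(X, N)) : Prop :=
  ∃ f₁' f₂' : C(X, N),
    f₁'.Homotopic f₁ ∧ f₂'.Homotopic f₂ ∧ ∀ x, f₁' x ≠ f₂' x

/-- Real projective `n`-space: the quotient of the unit sphere `Sⁿ ⊆ ℝ^{n+1}` by the
antipodal map, with the quotient topology. -/
def RealProjectiveSpace (n : ℕ) : Type :=
  Quot (fun x y : UnitSphere n =>
    (y : EuclideanSpace ℝ (Fin (n + 1))) = -(x : EuclideanSpace ℝ (Fin (n + 1))))

noncomputable instance (n : ℕ) : TopologicalSpace (RealProjectiveSpace n) :=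
  inferInstanceAs (TopologicalSpace (Quot _))

/-- The nonzero vectors of `E`. -/
abbrev Punctured (E : Type*) [Zero E] : Type _ := {x : E // x ≠ 0}

namespace Punctured

open Set ContinuousMap
open scoped ContDiff

section Homotopy

variable {X E : Type*} [TopologicalSpace X] [TopologicalSpace E] [Zero E]

theorem homotopic_of_family {f g : C(X, Punctured E)} (H : ℝ → X → E)
    (hH : Continuous fun p : ℝ × X => H p.1 p.2)
    (hne : ∀ s ∈ Icc (0 : ℝ) 1, ∀ x, H s x ≠ 0)
    (h0 : ∀ x, H 0 x = f x) (h1 : ∀ x, H 1 x = g x) : f.Homotopic g :=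
  ⟨{ toFun := fun p => ⟨H p.1 p.2, hne _ p.1.2 _⟩
     continuous_toFun := by
       refine Continuous.subtype_mk ?_ _
       exact hH.comp (by fun_prop : Continuous fun p : unitInterval × X => ((p.1 : ℝ), p.2))
     map_zero_left := fun x => Subtype.ext (by simpa using h0 x)
     map_one_left := fun x => Subtype.ext (by simpa using h1 x) }⟩

end Homotopy

variable {X E : Type*} [TopologicalSpace X] [NormedAddCommGroup E] [NormedSpace ℝ E]

theorem homotopic_of_segment {f g : C(X, Punctured E)}
    (h : ∀ x, ∀ s ∈ Icc (0 : ℝ) 1, (1 - s) • (f x : E) + s • (g x : E) ≠ 0) : f.Homotopic g :=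
  homotopic_of_family (fun s x => (1 - s) • (f x : E) + s • (g x : E)) (by fun_prop)
    (fun s hs x => h x s hs) (by simp) (by simp)

theorem homotopic_of_norm_sub_lt {f g : C(X, Punctured E)}
    (h : ∀ x, ‖(g x : E) - f x‖ < ‖(f x : E)‖) : f.Homotopic g := by
  refine homotopic_of_segment fun x s hs h0 => ?_
  have h1 : (f x : E) = -(s • ((g x : E) - f x)) := by
    have h4 : (f x : E) = ((1 - s) • (f x : E) + s • (g x : E)) - s • ((g x : E) - f x) := by
      module
    rw [h0, zero_sub] at h4
    exact h4
  have h2 := h x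
  have h3 : ‖(f x : E)‖ = s * ‖(g x : E) - f x‖ := by
    conv_lhs => rw [h1]
    rw [norm_neg, norm_smul, Real.norm_of_nonneg hs.1]
  nlinarith [hs.1, hs.2, norm_nonneg ((g x : E) - f x)]

/-- The restriction to nonzero vectors of a map vanishing at most at the origin. -/
@[simps]
def restrict {E F : Type*} [TopologicalSpace E] [Zero E] [TopologicalSpace F] [Zero F]
    (f : E → F) (hf : Continuous f) (h : ∀ x, x ≠ 0 → f x ≠ 0) :
    C(Punctured E, Punctured F) where
  toFun x := ⟨f x, h x x.2⟩

section Suspension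

variable {V : Type*} [NormedAddCommGroup V] [NormedSpace ℝ V]

/-- `Prod.map ψ id` as a self-map of the nonzero vectors of `V × ℝ`. -/
def suspend (ψ : V → V) (hψ : Continuous ψ) (h : ∀ x, x ≠ 0 → ψ x ≠ 0) :
    C(Punctured (V × ℝ), Punctured (V × ℝ)) :=
  restrict (fun p => (ψ p.1, p.2)) (by fun_prop) (by
    rintro ⟨v, t⟩ hp h0
    simp only [Prod.mk_eq_zero] at h0
    obtain ⟨h1, rfl⟩ := h0
    exact h v (fun hv => hp (by simp [hv])) h1)

open Classical in
/-- The norm-preserving extension of a parametrized self-map of the nonzero vectors of `V`. -/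
noncomputable def normPreserving {Y : Type*} [TopologicalSpace Y]
    (K : C(Y × Punctured V, Punctured V)) (y : Y) (w : V) : V :=
  if hw : w = 0 then 0 else (‖w‖ / ‖(K (y, ⟨w, hw⟩) : V)‖) • (K (y, ⟨w, hw⟩) : V)

variable {Y : Type*} [TopologicalSpace Y] (K : C(Y × Punctured V, Punctured V))

theorem normPreserving_of_ne (y : Y) (w : Punctured V) :
    normPreserving K y w = (‖(w : V)‖ / ‖(K (y, w) : V)‖) • (K (y, w) : V) := by
  rw [normPreserving, dif_neg w.2]

@[simp]
theorem norm_normPreserving (y : Y) (w : V) : ‖normPreserving K y w‖ = ‖w‖ := by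
  unfold normPreserving
  split_ifs with h0
  · simp [h0]
  · rw [norm_smul, norm_div, norm_norm, norm_norm,
      div_mul_cancel₀ _ (norm_ne_zero_iff.2 (K (y, ⟨w, h0⟩)).2)]

theorem normPreserving_eq_zero {y : Y} {w : V} : normPreserving K y w = 0 ↔ w = 0 := by
  rw [← norm_eq_zero, norm_normPreserving, norm_eq_zero]

theorem continuous_normPreserving :
    Continuous fun p : Y × V => normPreserving K p.1 p.2 := by
  rw [continuous_iff_continuousAt]
  rintro ⟨y, w⟩
  by_cases hw : w = 0
  · subst hw
    have h0 : normPreserving K y 0 = 0 := by simp [normPreserving]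
    unfold ContinuousAt
    simp only [h0]
    refine squeeze_zero_norm (a := fun p : Y × V => ‖p.2‖) (fun p => by simp) ?_
    simpa [Function.comp_def] using
      (continuous_norm.comp (continuous_snd (X := Y) (Y := V))).tendsto (y, 0)
  · have ho : IsOpen {p : Y × V | p.2 ≠ 0} := isOpen_ne_fun continuous_snd continuous_const
    have : ContinuousOn (fun p : Y × V => normPreserving K p.1 p.2) {p : Y × V | p.2 ≠ 0} := by
      rw [continuousOn_iff_continuous_domRestrict]
      have h2 : Continuous fun x : {p : Y × V | p.2 ≠ 0} =>
          (‖x.1.2‖ / ‖(K (x.1.1, ⟨x.1.2, x.2⟩) : V)‖) • (K (x.1.1, ⟨x.1.2, x.2⟩) : V) := by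
        refine Continuous.smul (Continuous.div (by fun_prop) (by fun_prop) fun x => ?_)
          (by fun_prop)
        exact norm_ne_zero_iff.2 (K _).2
      refine h2.congr fun x => ?_
      exact (normPreserving_of_ne K x.1.1 ⟨x.1.2, x.2⟩).symm
    exact this.continuousAt (ho.mem_nhds hw)

/-- A map which, on the two closed hemispheres, avoids the opposite pole is a suspension. -/
theorem homotopic_suspend {f : C(Punctured (V × ℝ), Punctured (V × ℝ))}
    (hpos : ∀ x, 0 ≤ x.1.2 → (f x).1.1 = 0 → 0 ≤ (f x).1.2)
    (hneg : ∀ x, x.1.2 ≤ 0 → (f x).1.1 = 0 → (f x).1.2 ≤ 0) :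
    ∃ h : C(Punctured V, Punctured V), ∀ (ψ : V → V) (hψ : Continuous ψ)
      (hψ0 : ∀ x, x ≠ 0 → ψ x ≠ 0), h.Homotopic (restrict ψ hψ hψ0) →
      f.Homotopic (suspend ψ hψ hψ0) := by
  have hne : ∀ x, (f x).1.1 = 0 → (f x).1.2 ≠ 0 := fun x h1 h2 => (f x).2 (Prod.ext h1 h2)
  have hequator : ∀ x : Punctured (V × ℝ), x.1.2 = 0 → (f x).1.1 ≠ 0 := fun x hx h0 =>
    hne x h0 (le_antisymm (hneg x hx.le h0) (hpos x hx.ge h0))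
  obtain ⟨μ, hμ0, hμ1, hμ⟩ := exists_continuous_zero_one_of_isClosed
    (s := {x : Punctured (V × ℝ) | (f x).1.1 = 0}) (t := {x : Punctured (V × ℝ) | x.1.2 = 0})
    (isClosed_eq (by fun_prop) (by fun_prop)) (isClosed_eq (by fun_prop) (by fun_prop))
    (by
      rw [Set.disjoint_left]
      exact fun x h1 h2 => hequator x h2 h1)
  let c : Punctured (V × ℝ) → ℝ := fun x =>
    if 0 ≤ x.1.2 then (1 - μ x) * |(f x).1.2| else -((1 - μ x) * |(f x).1.2|)
  have hc : Continuous c := by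
    refine Continuous.if_le (by fun_prop) (by fun_prop) (by fun_prop) (by fun_prop) fun x hx => ?_
    simp [hμ1 hx.symm]
  have hc0 : ∀ x, (f x).1.1 = 0 → c x = (f x).1.2 := by
    intro x hx
    have hμx : μ x = 0 := hμ0 hx
    simp only [c, hμx]
    split_ifs with h
    · simp [abs_of_nonneg (hpos x h hx)]
    · simp [abs_of_nonpos (hneg x (not_le.1 h).le hx)]
  have hμnn : ∀ x, 0 ≤ (1 - μ x) * |(f x).1.2| := fun x =>
    mul_nonneg (sub_nonneg.2 (hμ x).2) (abs_nonneg _)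
  have hcpos : ∀ x, 0 ≤ x.1.2 → 0 ≤ c x := fun x h => by
    simp only [c, if_pos h]; exact hμnn x
  have hcneg : ∀ x, x.1.2 < 0 → c x ≤ 0 := fun x h => by
    simp only [c, if_neg (not_le.2 h)]; exact neg_nonpos.2 (hμnn x)
  have hcequator : ∀ x, x.1.2 = 0 → c x = 0 := fun x h => by
    simp [c, h, hμ1 (show x ∈ {x : Punctured (V × ℝ) | x.1.2 = 0} from h)]
  let f' : C(Punctured (V × ℝ), Punctured (V × ℝ)) :=
    ⟨fun x => ⟨((f x).1.1, c x), fun h0 => by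
      rw [Prod.mk_eq_zero] at h0
      exact hne x h0.1 (by rw [← hc0 x h0.1, h0.2])⟩, by fun_prop⟩
  have hff' : f.Homotopic f' := by
    refine homotopic_of_segment fun x s hs h0 => ?_
    rw [Prod.ext_iff] at h0
    obtain ⟨h1, h2⟩ := h0
    have h3 : (f x).1.1 = 0 := by
      have : (1 - s) • (f x).1.1 + s • (f x).1.1 = 0 := h1
      rwa [← add_smul, sub_add_cancel, one_smul] at this
    have h4 : (1 - s) * (f x).1.2 + s * c x = 0 := h2
    rw [hc0 x h3] at h4
    exact hne x h3 (by linarith)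
  let h : C(Punctured V, Punctured V) :=
    ⟨fun w => ⟨(f ⟨((w : V), 0), fun h0 => w.2 (Prod.ext_iff.1 h0).1⟩).1.1, hequator _ rfl⟩,
      by fun_prop⟩
  refine ⟨h, fun ψ hψ hψ0 hhom => ?_⟩
  obtain ⟨H⟩ := hhom
  let S : unitInterval → C(Punctured (V × ℝ), Punctured (V × ℝ)) := fun s =>
    ⟨fun x => ⟨(normPreserving H.toContinuousMap s x.1.1, x.1.2), fun h0 => by
      rw [Prod.mk_eq_zero, normPreserving_eq_zero] at h0
      exact x.2 (Prod.ext h0.1 h0.2)⟩, by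
        have := continuous_normPreserving H.toContinuousMap
        have h2 : Continuous fun x : Punctured (V × ℝ) =>
          normPreserving H.toContinuousMap s x.1.1 :=
          this.comp (by fun_prop : Continuous fun x : Punctured (V × ℝ) => (s, x.1.1))
        fun_prop⟩
  have hSne : ∀ s x, ((S s x).1.1, (S s x).1.2) ≠ (0 : V × ℝ) := fun s x => (S s x).2
  have hS : (S 0).Homotopic (S 1) := by
    refine ⟨⟨⟨fun p => S p.1 p.2, ?_⟩, fun x => rfl, fun x => rfl⟩⟩
    have := continuous_normPreserving H.toContinuousMap
    have h2 : Continuous fun p : unitInterval × Punctured (V × ℝ) =>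
      normPreserving H.toContinuousMap p.1 p.2.1.1 :=
      this.comp (by fun_prop : Continuous
        fun p : unitInterval × Punctured (V × ℝ) => (p.1, p.2.1.1))
    exact Continuous.subtype_mk (by fun_prop) _
  refine hff'.trans (Homotopic.trans ?_ (hS.trans ?_))
  · refine homotopic_of_segment fun x s hs h0 => ?_
    rw [Prod.ext_iff] at h0
    obtain ⟨h1, h2⟩ := h0
    have h2 : (1 - s) * c x + s * x.1.2 = 0 := h2
    have h1 : (1 - s) • (f x).1.1 + s • normPreserving H.toContinuousMap 0 x.1.1 = 0 := h1
    by_cases hx : x.1.2 = 0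
    · obtain ⟨⟨w, t⟩, hx0⟩ := x
      obtain rfl : t = 0 := hx
      have hw : w ≠ 0 := fun h => hx0 (by simp [h])
      have h3 := normPreserving_of_ne H.toContinuousMap 0 ⟨w, hw⟩
      have h4 : (f ⟨(w, 0), hx0⟩).1.1 = h ⟨w, hw⟩ := rfl
      have h5 : H.toContinuousMap (0, ⟨w, hw⟩) = h ⟨w, hw⟩ := H.map_zero_left _
      simp only at h1 h3
      rw [h3, h4, h5, smul_smul, ← add_smul, smul_eq_zero] at h1
      have h6 : 0 < ‖w‖ / ‖(h ⟨w, hw⟩ : V)‖ :=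
        div_pos (norm_pos_iff.2 hw) (norm_pos_iff.2 (h ⟨w, hw⟩).2)
      rcases h1 with h1 | h1
      · rcases eq_or_lt_of_le hs.1 with h7 | h7
        · rw [← h7] at h1; norm_num at h1
        · nlinarith [hs.2, mul_pos h7 h6]
      · exact (h ⟨w, hw⟩).2 h1
    · have hs0 : s = 0 := by
        rcases lt_or_gt_of_ne hx with h3 | h3
        · have := hcneg x h3
          by_contra hs0
          have : 0 < s := lt_of_le_of_ne hs.1 (Ne.symm hs0)
          nlinarith [hs.2]
        · have := hcpos x h3.le
          by_contra hs0
          have : 0 < s := lt_of_le_of_ne hs.1 (Ne.symm hs0)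
          nlinarith [hs.2]
      subst hs0
      exact (f' x).2 (Prod.ext (show (f x).1.1 = 0 by simpa using h1)
        (show c x = 0 by simpa using h2))
  · refine homotopic_of_segment fun x s hs h0 => ?_
    rw [Prod.ext_iff] at h0
    obtain ⟨h1, h2⟩ := h0
    have h2 : (1 - s) * x.1.2 + s * x.1.2 = 0 := h2
    have h1 : (1 - s) • normPreserving H.toContinuousMap 1 x.1.1 + s • ψ x.1.1 = 0 := h1
    have hx2 : x.1.2 = 0 := by linarith
    have hx1 : x.1.1 ≠ 0 := fun h => x.2 (Prod.ext h hx2)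
    have h3 := normPreserving_of_ne H.toContinuousMap 1 ⟨x.1.1, hx1⟩
    have h5 : (H.toContinuousMap (1, ⟨x.1.1, hx1⟩) : V) = ψ x.1.1 :=
      congrArg Subtype.val (H.map_one_left _)
    simp only at h3
    rw [h3, h5, smul_smul, ← add_smul, smul_eq_zero] at h1
    have h6 : 0 < ‖x.1.1‖ / ‖ψ x.1.1‖ :=
      div_pos (norm_pos_iff.2 hx1) (norm_pos_iff.2 (hψ0 _ hx1))
    rcases h1 with h1 | h1
    · rcases eq_or_lt_of_le hs.2 with h7 | h7
      · rw [h7] at h1; norm_num at h1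
      · nlinarith [hs.1, mul_pos (sub_pos.2 h7) h6]
    · exact hψ0 _ hx1 h1

end Suspension

section Regular

theorem homotopic_of_pos_smul {X E : Type*} [TopologicalSpace X] [NormedAddCommGroup E]
    [NormedSpace ℝ E] {f g : C(X, Punctured E)}
    (h : ∀ x, ∃ c : ℝ, 0 < c ∧ (g x : E) = c • (f x : E)) : f.Homotopic g := by
  refine homotopic_of_segment fun x s hs h0 => ?_
  obtain ⟨c, hc, hx⟩ := h x
  rw [hx, smul_smul, ← add_smul, smul_eq_zero] at h0
  rcases h0 with h1 | h1
  · rcases eq_or_lt_of_le hs.2 with h7 | h7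
    · rw [h7] at h1; linarith
    · nlinarith [hs.1, mul_nonneg hs.1 hc.le]
  · exact (f x).2 h1

variable {E : Type*} [NormedAddCommGroup E]

theorem finite_preimage_of_det_ne_zero [NormedSpace ℝ E] [FiniteDimensional ℝ E] {g : E → E}
    {y : E} (hcpt : IsCompact (g ⁻¹' {y}))
    (hg : ∀ x, g x = y → ContDiffAt ℝ 1 g x ∧ (fderiv ℝ g x).det ≠ 0) : (g ⁻¹' {y}).Finite := by
  refine hcpt.finite ?_
  rw [isDiscrete_iff_nhdsNE]
  intro x hx
  obtain ⟨h1, h2⟩ := hg x hx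
  let A := (fderiv ℝ g x).toContinuousLinearEquivOfDetNeZero h2
  have h3 := (h1.differentiableAt one_ne_zero).hasFDerivAt.eventually_ne (c := y)
    ⟨_, A.antilipschitz⟩
  rw [← disjoint_iff, Filter.disjoint_principal_right]
  exact h3

theorem exists_homogeneous_of_innerProductSpace [InnerProductSpace ℝ E] [FiniteDimensional ℝ E]
    (f : C(Punctured E, Punctured E)) :
    ∃ (g : E → E) (hg : Continuous g) (hg0 : ∀ x, x ≠ 0 → g x ≠ 0),
      f.Homotopic (restrict g hg hg0) ∧ (∀ c : ℝ, 0 < c → ∀ x, g (c • x) = c • g x) ∧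
      Dense {y | (g ⁻¹' {y}).Finite ∧ (g ⁻¹' {-y}).Finite} := by
  let r : C(Punctured E, Punctured E) :=
    ⟨fun x => ⟨‖(x : E)‖⁻¹ • (x : E), smul_ne_zero (inv_ne_zero (norm_ne_zero_iff.2 x.2)) x.2⟩, by
      refine Continuous.subtype_mk (Continuous.smul (Continuous.inv₀ (by fun_prop) fun x => ?_)
        (by fun_prop)) _
      exact norm_ne_zero_iff.2 x.2⟩
  have hr : ∀ x, ‖(r x : E)‖ = 1 := fun x => by
    simp [r, norm_smul, inv_mul_cancel₀ (norm_ne_zero_iff.2 x.2)]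
  have hrid : (ContinuousMap.id _).Homotopic r :=
    homotopic_of_pos_smul fun x => ⟨_, inv_pos.2 (norm_pos_iff.2 x.2), rfl⟩
  let K : C(Unit × Punctured E, Punctured E) := f.comp ⟨Prod.snd, continuous_snd⟩
  let F : E → E := normPreserving K ()
  have hF : Continuous F := (continuous_normPreserving K).comp (by fun_prop :
    Continuous fun x : E => ((), x))
  obtain ⟨G, hG, hGF, -⟩ := hF.exists_contDiff_approx ⊤ (ε := fun _ => 1 / 2) continuous_const
    (fun _ => by norm_num)
  have hFn : ∀ x, ‖F x‖ = ‖x‖ := fun x => norm_normPreserving K () x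
  simp only [dist_eq_norm] at hGF
  have hGlow : ∀ x : E, ‖x‖ = 1 → 1 / 2 ≤ ‖G x‖ := fun x hx => by
    have h1 := hGF x
    have h2 := norm_sub_norm_le (F x) (G x)
    rw [hFn, hx, norm_sub_rev] at h2
    linarith
  have hGup : ∀ x : E, ‖x‖ = 1 → ‖G x‖ ≤ 2 := fun x hx => by
    have h1 := hGF x
    have h2 := norm_sub_norm_le (G x) (F x)
    rw [hFn, hx] at h2
    linarith
  let g : E → E := fun x => ‖x‖ • G (‖x‖⁻¹ • x)
  have hunit : ∀ x : E, x ≠ 0 → ‖‖x‖⁻¹ • x‖ = 1 := fun x hx => hr ⟨x, hx⟩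
  have hgup : ∀ x, ‖g x‖ ≤ 2 * ‖x‖ := fun x => by
    by_cases hx : x = 0
    · simp [g, hx]
    · rw [norm_smul, norm_norm, mul_comm]
      exact mul_le_mul_of_nonneg_right (hGup _ (hunit x hx)) (norm_nonneg _)
  have hglow : ∀ x, 1 / 2 * ‖x‖ ≤ ‖g x‖ := fun x => by
    by_cases hx : x = 0
    · simp [g, hx]
    · rw [norm_smul, norm_norm, mul_comm]
      exact mul_le_mul_of_nonneg_left (hGlow _ (hunit x hx)) (norm_nonneg _)
  have hgsmooth : ∀ x, x ≠ 0 → ContDiffAt ℝ 1 g x := fun x hx => by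
    have h1 : ContDiffAt ℝ 1 (fun x : E => ‖x‖) x := contDiffAt_norm ℝ hx
    have h2 : ContDiffAt ℝ 1 G (‖x‖⁻¹ • x) := hG.contDiffAt.of_le (by exact_mod_cast le_top)
    have h3 : ContDiffAt ℝ 1 (fun y : E => ‖y‖⁻¹ • y) x :=
      (h1.inv (norm_ne_zero_iff.2 hx)).smul contDiffAt_id
    exact h1.smul (ContDiffAt.comp (f := fun y : E => ‖y‖⁻¹ • y) x h2 h3)
  have hg0 : g 0 = 0 := by simp [g]
  have hgc : Continuous g := by
    rw [continuous_iff_continuousAt]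
    intro x
    by_cases hx : x = 0
    · subst hx
      unfold ContinuousAt
      rw [hg0]
      refine squeeze_zero_norm (a := fun x : E => 2 * ‖x‖) hgup ?_
      simpa using ((continuous_norm (E := E)).tendsto 0).const_mul 2
    · exact (hgsmooth x hx).continuousAt
  have hgne : ∀ x, x ≠ 0 → g x ≠ 0 := fun x hx h0 => by
    have := hglow x
    rw [h0, norm_zero] at this
    have := norm_pos_iff.2 hx
    linarith
  refine ⟨g, hgc, hgne, ?_, ?_, ?_⟩
  · have h1 : f.Homotopic (f.comp r) := by
      simpa using (Homotopic.refl f).comp hrid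
    have hFr : ∀ x : Punctured E, ‖(x : E)‖ • F (r x) ≠ 0 := fun x => by
      rw [← norm_ne_zero_iff, norm_smul, hFn, hr]
      simpa using x.2
    refine h1.trans (Homotopic.trans (g := ⟨fun x => ⟨_, hFr x⟩, by fun_prop⟩)
      (homotopic_of_pos_smul fun x => ?_) (homotopic_of_norm_sub_lt fun x => ?_))
    · refine ⟨‖(x : E)‖ * (1 / ‖(f (r x) : E)‖), mul_pos (norm_pos_iff.2 x.2)
        (one_div_pos.2 (norm_pos_iff.2 (f (r x)).2)), ?_⟩
      have h2 : F (r x) = (‖(r x : E)‖ / ‖(f (r x) : E)‖) • (f (r x) : E) :=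
        normPreserving_of_ne K () (r x)
      rw [hr] at h2
      simp only [ContinuousMap.coe_mk, h2, smul_smul, ContinuousMap.comp_apply]
    · have h2 : (restrict g hgc hgne x : E) = ‖(x : E)‖ • G (r x) := rfl
      simp only [ContinuousMap.coe_mk, h2, ← smul_sub, norm_smul, hFn, hr]
      have := hGF (r x)
      have := norm_pos_iff.2 x.2
      rw [norm_norm]
      nlinarith
  · intro c hc x
    simp only [g, norm_smul, Real.norm_of_nonneg hc.le, mul_inv, smul_smul]
    congr 3
    field_simp
  · borelize E
    let C : Set E := {x | x ≠ 0 ∧ (fderiv ℝ g x).det = 0}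
    have hC : MeasureTheory.volume (g '' C) = 0 :=
      MeasureTheory.addHaar_image_eq_zero_of_det_fderivWithin_eq_zero _
        (fun x hx => ((hgsmooth x hx.1).differentiableAt one_ne_zero).hasFDerivAt.hasFDerivWithinAt)
        (fun x hx => hx.2)
    have hfin : ∀ y, y ∉ g '' C → (g ⁻¹' {y}).Finite := by
      intro y hy
      by_cases hy0 : y = 0
      · refine (Set.finite_singleton (0 : E)).subset fun x hx => ?_
        by_contra hx0
        exact hgne x hx0 (hx.trans hy0)
      · refine finite_preimage_of_det_ne_zero ?_ fun x hx => ?_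
        · refine (isCompact_closedBall (0 : E) (2 * ‖y‖)).of_isClosed_subset
            (isClosed_singleton.preimage hgc) fun x hx => ?_
          have h1 := hglow x
          rw [show g x = y from hx] at h1
          rw [mem_closedBall_zero_iff]
          linarith
        · have hx0 : x ≠ 0 := by
            rintro rfl
            exact hy0 (hx ▸ hg0)
          exact ⟨hgsmooth x hx0, fun h => hy ⟨x, ⟨hx0, h⟩, hx⟩⟩
    have hC' : MeasureTheory.volume (-(g '' C)) = 0 := by
      rw [MeasureTheory.Measure.measure_neg, hC]
    have hU := MeasureTheory.measure_union_null hC hC'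
    have hd : Dense (g '' C ∪ -(g '' C))ᶜ := by
      rw [← interior_eq_empty_iff_dense_compl]
      exact MeasureTheory.Measure.interior_eq_empty_of_null hU
    refine hd.mono fun y hy => ?_
    simp only [mem_compl_iff, mem_union, Set.mem_neg, not_or] at hy
    exact ⟨hfin _ hy.1, hfin _ hy.2⟩

/-- Every self-map of the nonzero vectors is homotopic to a positively homogeneous one for which
a generic pair of opposite values has finitely many preimages. -/
theorem exists_homogeneous [NormedSpace ℝ E] [FiniteDimensional ℝ E]
    (f : C(Punctured E, Punctured E)) :
    ∃ (g : E → E) (hg : Continuous g) (hg0 : ∀ x, x ≠ 0 → g x ≠ 0),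
      f.Homotopic (restrict g hg hg0) ∧ (∀ c : ℝ, 0 < c → ∀ x, g (c • x) = c • g x) ∧
      Dense {y | (g ⁻¹' {y}).Finite ∧ (g ⁻¹' {-y}).Finite} := by
  let e : E ≃L[ℝ] EuclideanSpace ℝ (Fin (Module.finrank ℝ E)) := toEuclidean
  let e1 := restrict e e.continuous (fun x hx => by simpa using hx)
  let e2 := restrict e.symm e.symm.continuous (fun x hx => by simpa using hx)
  obtain ⟨g, hg, hg0, hfg, hh, hd⟩ :=
    exists_homogeneous_of_innerProductSpace ((e1.comp f).comp e2)
  refine ⟨fun x => e.symm (g (e x)), by fun_prop, fun x hx => ?_, ?_, ?_, ?_⟩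
  · simpa using hg0 (e x) (by simpa using hx)
  · have h1 := ((Homotopic.refl e2).comp hfg).comp (Homotopic.refl e1)
    have h2 : ∀ x, e2 (e1 x) = x := fun x => Subtype.ext (by simp [e1, e2])
    convert! h1 using 1
    ext x
    simp only [ContinuousMap.comp_apply, h2]
  · intro c hc x
    simp [hh c hc]
  · have h1 := hd.preimage e.toHomeomorph.isOpenMap
    refine h1.mono fun y hy => ?_
    simp only [mem_preimage, mem_ofPred_eq] at hy ⊢
    refine ⟨(hy.1.preimage e.injective.injOn).subset fun x hx => ?_,
      (hy.2.preimage e.injective.injOn).subset fun x hx => ?_⟩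
    · simp only [mem_preimage, mem_singleton_iff, ContinuousLinearEquiv.symm_apply_eq] at hx ⊢
      exact hx
    · simp only [mem_preimage, mem_singleton_iff, ContinuousLinearEquiv.symm_apply_eq,
        map_neg] at hx ⊢
      exact hx

end Regular

section Separation

variable {V : Type*} [NormedAddCommGroup V] [NormedSpace ℝ V]

/-- A positively homogeneous function whose graph separates two finite sets of vectors. -/
theorem exists_separating {P Q : Set (V × ℝ)} (hP : P.Finite) (hQ : Q.Finite)
    (hP0 : ∀ p ∈ P, p.1 ≠ 0) (hQ0 : ∀ q ∈ Q, q.1 ≠ 0)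
    (hPQ : ∀ p ∈ P, ∀ q ∈ Q, ∀ c : ℝ, 0 < c → p.1 ≠ c • q.1) :
    ∃ τ : V → ℝ, Continuous τ ∧ τ 0 = 0 ∧ (∀ c : ℝ, 0 < c → ∀ w, τ (c • w) = c * τ w) ∧
      (∀ p ∈ P, τ p.1 < p.2) ∧ ∀ q ∈ Q, q.2 < τ q.1 := by
  obtain ⟨ρ, hρ0, hρ1, hρ⟩ := exists_continuous_zero_one_of_isClosed
    (s := (fun p : V × ℝ => ‖p.1‖⁻¹ • p.1) '' P) (t := (fun p : V × ℝ => ‖p.1‖⁻¹ • p.1) '' Q)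
    (hP.image _).isClosed (hQ.image _).isClosed (by
      rw [Set.disjoint_left]
      rintro _ ⟨p, hp, rfl⟩ ⟨q, hq, hpq⟩
      have h1 := norm_pos_iff.2 (hP0 p hp)
      have h2 := norm_pos_iff.2 (hQ0 q hq)
      refine hPQ p hp q hq (‖p.1‖ * ‖q.1‖⁻¹) (by positivity) ?_
      simp only at hpq
      rw [mul_smul, hpq, smul_smul, mul_inv_cancel₀ h1.ne', one_smul])
  obtain ⟨M, hM⟩ := ((hP.union hQ).image fun p : V × ℝ => |p.2| / ‖p.1‖).bddAbove
  have hM' : ∀ p ∈ P ∪ Q, p.1 ≠ 0 → |p.2| < (M + 1) * ‖p.1‖ := fun p hp h0 => by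
    have h1 : |p.2| / ‖p.1‖ ≤ M := hM (mem_image_of_mem _ hp)
    have h2 := norm_pos_iff.2 h0
    rw [div_le_iff₀ h2] at h1
    linarith
  refine ⟨fun w => ‖w‖ * ((M + 1) * (2 * ρ (‖w‖⁻¹ • w) - 1)), ?_, by simp, ?_, ?_, ?_⟩
  · rw [continuous_iff_continuousAt]
    intro w
    by_cases hw : w = 0
    · subst hw
      unfold ContinuousAt
      simp only [norm_zero, zero_mul]
      refine squeeze_zero_norm (a := fun w : V => ‖w‖ * |M + 1|) (fun w => ?_) ?_
      · rw [norm_mul, norm_norm, norm_mul, Real.norm_eq_abs]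
        refine mul_le_mul_of_nonneg_left ?_ (norm_nonneg _)
        refine mul_le_of_le_one_right (abs_nonneg _) ?_
        have := hρ (‖w‖⁻¹ • w)
        rw [Real.norm_eq_abs, abs_le]
        constructor <;> linarith [this.1, this.2]
      · simpa using ((continuous_norm (E := V)).tendsto 0).mul_const |M + 1|
    · have h1 : ContinuousAt (fun w : V => ‖w‖⁻¹ • w) w :=
        (continuous_norm.continuousAt.inv₀ (norm_ne_zero_iff.2 hw)).smul continuousAt_id
      have h2 : ContinuousAt (fun w : V => ρ (‖w‖⁻¹ • w)) w :=
        ContinuousAt.comp (f := fun w : V => ‖w‖⁻¹ • w) ρ.continuous.continuousAt h1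
      fun_prop
  · intro c hc w
    have h1 : ‖c • w‖⁻¹ • (c • w) = ‖w‖⁻¹ • w := by
      rw [norm_smul, Real.norm_of_nonneg hc.le, smul_smul]
      congr 1
      field_simp
    simp only [h1]
    rw [norm_smul, Real.norm_of_nonneg hc.le, mul_assoc]
  · intro p hp
    have h1 : ρ (‖p.1‖⁻¹ • p.1) = 0 := hρ0 (mem_image_of_mem _ hp)
    have h2 := neg_abs_le p.2
    have h3 := hM' p (Or.inl hp) (hP0 p hp)
    simp only [h1]
    linarith
  · intro p hp
    have h1 : ρ (‖p.1‖⁻¹ • p.1) = 1 := hρ1 (mem_image_of_mem _ hp)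
    have h2 := le_abs_self p.2
    have h3 := hM' p (Or.inr hp) (hQ0 p hp)
    simp only [h1]
    linarith

theorem exists_notMem_span_pair [FiniteDimensional ℝ V] (hV : 2 ≤ Module.finrank ℝ V)
    {P : Set (V × ℝ)} (hP : P.Finite) :
    ∃ a : V × ℝ, a.2 ≠ 0 ∧ ∀ p ∈ P, ∀ q ∈ P, a ∉ Submodule.span ℝ {p, q} := by
  let Z : Set (Submodule ℝ (V × ℝ)) := insert (LinearMap.ker (LinearMap.snd ℝ V ℝ))
    ((fun p : (V × ℝ) × (V × ℝ) => Submodule.span ℝ {p.1, p.2}) '' (P ×ˢ P))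
  have hZ : Z.Finite := ((hP.prod hP).image _).insert _
  have htop : ⊤ ∉ Z := by
    rintro (h | ⟨⟨p, q⟩, -, h⟩)
    · have : ((0 : V), (1 : ℝ)) ∈ LinearMap.ker (LinearMap.snd ℝ V ℝ) := h ▸ Submodule.mem_top
      simp at this
    · classical
      have h1 : Module.finrank ℝ (Submodule.span ℝ (({p, q} : Finset (V × ℝ)) : Set (V × ℝ))) ≤ _ :=
        finrank_span_finset_le_card _
      have h2 := Finset.card_le_two (a := p) (b := q)
      simp only at h
      rw [Finset.coe_pair, h, finrank_top, Module.finrank_prod, Module.finrank_self] at h1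
      omega
  have h := Subspace.biUnion_ne_univ_of_top_notMem (s := hZ.toFinset) (by rwa [Finite.mem_toFinset])
  obtain ⟨a, ha⟩ := (ne_univ_iff_exists_notMem _).1 h
  simp only [Finite.mem_toFinset, mem_iUnion, SetLike.mem_coe, not_exists] at ha
  exact ⟨a, fun h0 => ha _ (mem_insert _ _) (by simpa using h0), fun p hp q hq =>
    ha _ (mem_insert_of_mem _ ⟨(p, q), ⟨hp, hq⟩, rfl⟩)⟩

/-- Every self-map of the nonzero vectors of `V × ℝ` is homotopic to one which, on the two
closed hemispheres, avoids the opposite pole. -/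
theorem exists_homotopic_avoiding [FiniteDimensional ℝ V] (hV : 2 ≤ Module.finrank ℝ V)
    (f : C(Punctured (V × ℝ), Punctured (V × ℝ))) :
    ∃ f' : C(Punctured (V × ℝ), Punctured (V × ℝ)), f.Homotopic f' ∧
      (∀ x, 0 ≤ x.1.2 → (f' x).1.1 = 0 → 0 ≤ (f' x).1.2) ∧
      ∀ x, x.1.2 ≤ 0 → (f' x).1.1 = 0 → (f' x).1.2 ≤ 0 := by
  obtain ⟨g, hg, hg0, hfg, hh, hd⟩ := exists_homogeneous f
  have hzero : g 0 = 0 := by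
    have := hh 2 two_pos 0
    rw [smul_zero, two_smul] at this
    simpa using this
  obtain ⟨y, ⟨hA, hB⟩, hy⟩ := hd.inter_open_nonempty {y : V × ℝ | 0 < y.2}
    (isOpen_lt continuous_const continuous_snd) ⟨(0, 1), by simp⟩ |>.imp fun _ h => h.symm
  have hy : 0 < y.2 := hy
  have hy0 : y ≠ 0 := fun h => by simp [h] at hy
  set A := g ⁻¹' {y} with hAdef
  set B := g ⁻¹' {-y} with hBdef
  obtain ⟨a, ha, hspan⟩ := exists_notMem_span_pair hV (hA.union hB)
  let v := y.2⁻¹ • y.1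
  let v' := a.2⁻¹ • a.1
  have hyv : y = (y.2 • v, y.2) := Prod.ext (by simp [v, smul_smul, hy.ne']) rfl
  have hray : ∀ p ∈ A ∪ B, ∀ q ∈ A ∪ B, ∀ r ∈ Submodule.span ℝ {p, q},
      r.1 = r.2 • v' → r = 0 := by
    intro p hp q hq r hr hrv
    by_cases h0 : r.2 = 0
    · exact Prod.ext (by rw [hrv, h0, zero_smul]; rfl) h0
    · refine absurd ?_ (hspan p hp q hq)
      have : a = (a.2 / r.2) • r := by
        refine Prod.ext ?_ ?_
        · rw [Prod.smul_fst, hrv, smul_smul, div_mul_cancel₀ _ h0]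
          simp [v', smul_smul, ha]
        · rw [Prod.smul_snd, smul_eq_mul, div_mul_cancel₀ _ h0]
      rw [this]
      exact Submodule.smul_mem _ _ hr
  have hne : ∀ p ∈ A ∪ B, p ≠ 0 := by
    rintro p hp rfl
    rcases hp with hp | hp
    · exact hy0 (hp.symm.trans hzero)
    · exact hy0 (neg_eq_zero.1 (hp.symm.trans hzero))
  let R : V × ℝ → V × ℝ := fun p => (p.1 - p.2 • v', p.2)
  have hR0 : ∀ p ∈ A ∪ B, (R p).1 ≠ 0 := fun p hp h0 =>
    hne p hp (hray p hp p hp p (Submodule.subset_span (by simp)) (sub_eq_zero.1 h0))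
  obtain ⟨τ, hτ, hτ0, hτh, hτA, hτB⟩ := exists_separating (hA.image R) (hB.image R)
    (by rintro _ ⟨p, hp, rfl⟩; exact hR0 p (Or.inl hp))
    (by rintro _ ⟨p, hp, rfl⟩; exact hR0 p (Or.inr hp))
    (by
      rintro _ ⟨p, hp, rfl⟩ _ ⟨q, hq, rfl⟩ c hc h
      have h1 := hray p (Or.inl hp) q (Or.inr hq) (p - c • q)
        (sub_mem (Submodule.subset_span (by simp))
          (Submodule.smul_mem _ _ (Submodule.subset_span (by simp)))) (by
          simp only [R, smul_sub, smul_smul] at h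
          simp only [Prod.fst_sub, Prod.smul_fst, Prod.snd_sub, Prod.smul_snd, sub_smul,
            smul_eq_mul]
          rw [sub_eq_sub_iff_add_eq_add] at h ⊢
          rw [h]
          abel)
      have h2 : g p = c • g q := by rw [sub_eq_zero.1 h1, hh c hc]
      have hp' : g p = y := hp
      have hq' : g q = -y := hq
      rw [hp', hq', smul_neg, eq_neg_iff_add_eq_zero] at h2
      have h3 : (1 + c) • y = 0 := by rw [add_smul, one_smul, h2]
      rcases smul_eq_zero.1 h3 with h4 | h4
      · linarith
      · exact hy0 h4)
  have hshear : ∀ (u : V) (s : ℝ) (x : V × ℝ), x ≠ 0 → (x.1 + (s * x.2) • u, x.2) ≠ 0 := by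
    intro u s x hx h0
    rw [Prod.mk_eq_zero] at h0
    exact hx (Prod.ext (by simpa [h0.2] using h0.1) h0.2)
  have hshear' : ∀ (u : V) (x : V × ℝ), x ≠ 0 → (x.1 + x.2 • u, x.2) ≠ 0 := fun u x hx => by
    simpa using hshear u 1 x hx
  let T : V → C(Punctured (V × ℝ), Punctured (V × ℝ)) := fun u =>
    restrict (fun x => (x.1 + x.2 • u, x.2)) (by fun_prop) (hshear' u)
  have hT : ∀ u, (ContinuousMap.id _).Homotopic (T u) := fun u =>
    homotopic_of_family (fun s x => (x.1.1 + (s * x.1.2) • u, x.1.2)) (by fun_prop)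
      (fun s _ x => hshear u s x x.2) (by simp) (by simp [T])
  have hθne : ∀ (s : ℝ) (x : V × ℝ), x ≠ 0 → (x.1, x.2 + s * τ x.1) ≠ 0 := by
    intro s x hx h0
    rw [Prod.mk_eq_zero] at h0
    refine hx (Prod.ext h0.1 ?_)
    simpa [h0.1, hτ0] using h0.2
  let θ : C(Punctured (V × ℝ), Punctured (V × ℝ)) :=
    restrict (fun x => (x.1, x.2 + τ x.1)) (by fun_prop) fun x hx => by simpa using hθne 1 x hx
  have hθ : (ContinuousMap.id _).Homotopic θ :=
    homotopic_of_family (fun s x => (x.1.1, x.1.2 + s * τ x.1.1)) (by fun_prop)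
      (fun s _ x => hθne s x x.2) (by simp) (by simp [θ])
  let G := restrict g hg hg0
  have key : ∀ (x : Punctured (V × ℝ)) (c : ℝ) (z : V × ℝ), 0 < c →
      g (T v' (θ x)) = c • z → g (c⁻¹ • (T v' (θ x) : V × ℝ)) = z ∧
      x.1.2 = c * ((R (c⁻¹ • (T v' (θ x) : V × ℝ))).2 - τ (R (c⁻¹ • (T v' (θ x) : V × ℝ))).1) := by
    intro x c z hc hz
    refine ⟨by rw [hh _ (inv_pos.2 hc), hz, smul_smul, inv_mul_cancel₀ hc.ne', one_smul], ?_⟩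
    have h1 : R (c⁻¹ • (T v' (θ x) : V × ℝ)) = c⁻¹ • (θ x : V × ℝ) := by
      refine Prod.ext ?_ rfl
      simp [R, T, smul_smul]
    rw [h1, Prod.smul_fst, Prod.smul_snd, hτh _ (inv_pos.2 hc), smul_eq_mul, ← mul_sub,
      mul_inv_cancel_left₀ hc.ne']
    simp [θ]
  have hTG : ∀ x, (((T (-v)).comp (G.comp ((T v').comp θ))) x).1 =
    ((g (T v' (θ x))).1 + (g (T v' (θ x))).2 • -v, (g (T v' (θ x))).2) := fun x => rfl
  refine ⟨(T (-v)).comp (G.comp ((T v').comp θ)), ?_, ?_, ?_⟩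
  · simpa using (hT (-v)).comp (hfg.comp ((hT v').comp hθ))
  · intro x hx h1
    rw [hTG] at h1 ⊢
    simp only at h1 ⊢
    set z := g (T v' (θ x)) with hz
    by_contra! h2
    have hc : 0 < -z.2 / y.2 := div_pos (by linarith) hy
    have h3 : z = (-z.2 / y.2) • (-y) := by
      refine Prod.ext ?_ ?_
      · rw [smul_neg, ← sub_eq_add_neg, sub_eq_zero] at h1
        rw [h1, hyv]
        simp [smul_smul, hy.ne']
      · simp [hy.ne']
    obtain ⟨h4, h5⟩ := key x _ _ hc h3
    have h6 := hτB _ (mem_image_of_mem R h4)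
    rw [h5] at hx
    nlinarith
  · intro x hx h1
    rw [hTG] at h1 ⊢
    simp only at h1 ⊢
    set z := g (T v' (θ x)) with hz
    by_contra! h2
    have hc : 0 < z.2 / y.2 := div_pos (by linarith) hy
    have h3 : z = (z.2 / y.2) • y := by
      refine Prod.ext ?_ ?_
      · rw [smul_neg, ← sub_eq_add_neg, sub_eq_zero] at h1
        rw [h1, hyv]
        simp [smul_smul, hy.ne']
      · simp [hy.ne']
    obtain ⟨h4, h5⟩ := key x _ _ hc h3
    have h6 := hτA _ (mem_image_of_mem R h4)
    rw [h5] at hx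
    nlinarith

end Separation

theorem exists_eq_zpow_mul_exp (f : C(Punctured ℂ, Punctured ℂ)) :
    ∃ (k : ℤ) (g : C(Punctured ℂ, ℂ)), ∀ w, (f w : ℂ) = (w : ℂ) ^ k * Complex.exp (g w) := by
  let q : C(ℂ, Punctured ℂ) := ⟨fun z => ⟨_, z.exp_ne_zero⟩, by fun_prop⟩
  have hq : IsCoveringMap q := Complex.isCoveringMap_exp
  have hlift := hq.existsUnique_continuousMap_lifts (f.comp q) 0 (Complex.log (f (q 0)))
    (Subtype.ext (Complex.exp_log (f (q 0)).2))
  obtain ⟨F, ⟨-, hF⟩, -⟩ := hlift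
  have hF' : ∀ z, Complex.exp (F z) = f (q z) := fun z => congrArg Subtype.val (congrFun hF z)
  have hqper : ∀ z, q (z + 2 * Real.pi * Complex.I) = q z := fun z =>
    Subtype.ext (Complex.exp_periodic z)
  obtain ⟨k, hk⟩ := Complex.exp_eq_exp_iff_exists_int.1
    (show Complex.exp (F (0 + 2 * Real.pi * Complex.I)) = Complex.exp (F 0) by
      rw [hF', hF', hqper])
  have hper : ∀ z, F (z + 2 * Real.pi * Complex.I) = F z + k * (2 * Real.pi * Complex.I) := by
    have huniq := (hq.existsUnique_continuousMap_lifts (f.comp q) 0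
      (F (0 + 2 * Real.pi * Complex.I)) (Subtype.ext (by
        change Complex.exp _ = _
        rw [hF', hqper]; rfl))).unique
      (y₁ := ⟨fun z => F (z + 2 * Real.pi * Complex.I), by fun_prop⟩)
      (y₂ := ⟨fun z => F z + k * (2 * Real.pi * Complex.I), by fun_prop⟩)
      ⟨rfl, funext fun z => Subtype.ext (by
        change Complex.exp _ = _
        rw [ContinuousMap.coe_mk, hF', hqper]; rfl)⟩
      ⟨hk.symm, funext fun z => Subtype.ext (by
        change Complex.exp _ = _
        rw [ContinuousMap.coe_mk, Complex.exp_add, Complex.exp_int_mul_two_pi_mul_I, mul_one, hF']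
        rfl)⟩
    exact fun z => DFunLike.congr_fun huniq z
  let G : C(ℂ, ℂ) := ⟨fun z => F z - k * z, by fun_prop⟩
  have hG : Function.Periodic G (2 * Real.pi * Complex.I) := fun z => by
    simp only [G, ContinuousMap.coe_mk, hper]
    ring
  have hquot : Topology.IsQuotientMap q := Complex.isAddQuotientCoveringMap_exp.toIsQuotientMap
  have hfac : Function.FactorsThrough G q := by
    intro z z' h
    obtain ⟨n, hn⟩ := Complex.exp_eq_exp_iff_exists_int.1 (congrArg Subtype.val h)
    rw [hn, ← hG.int_mul n z']
  refine ⟨k, hquot.lift G hfac, fun w => ?_⟩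
  obtain ⟨z, rfl⟩ := hquot.surjective w
  have h1 : hquot.lift G hfac (q z) = G z := DFunLike.congr_fun (hquot.lift_comp G hfac) z
  rw [h1, ← hF']
  change _ = Complex.exp z ^ k * _
  rw [← Complex.exp_int_mul, ← Complex.exp_add]
  simp [G]

/-- Self-maps of the punctured plane are homotopic to powers, up to conjugation. -/
theorem exists_homotopic_pow (f : C(Punctured ℂ, Punctured ℂ)) :
    ∃ (σ : ℂ ≃L[ℝ] ℂ) (m : ℕ), f.Homotopic (restrict (fun z => σ z ^ m) (by fun_prop)
      fun z hz => pow_ne_zero m (by simpa using hz)) := by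
  obtain ⟨k, g, hg⟩ := exists_eq_zpow_mul_exp f
  have hz : Continuous fun w : Punctured ℂ => (w : ℂ) ^ k :=
    continuous_subtype_val.zpow₀ k fun w => Or.inl w.2
  have hf : f.Homotopic ⟨fun w => ⟨(w : ℂ) ^ k, zpow_ne_zero k w.2⟩, by fun_prop⟩ := by
    refine homotopic_of_family (fun s w => (w : ℂ) ^ k * Complex.exp ((1 - s : ℝ) * g w)) ?_
      (fun s _ w => mul_ne_zero (zpow_ne_zero k w.2) (Complex.exp_ne_zero _)) ?_ ?_
    · have := hz.comp (continuous_snd (X := ℝ) (Y := Punctured ℂ))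
      fun_prop
    · intro w
      simp [hg]
    · intro w
      simp
  obtain ⟨m, rfl | rfl⟩ := k.eq_nat_or_neg
  · refine ⟨ContinuousLinearEquiv.refl ℝ ℂ, m, hf.trans ?_⟩
    exact homotopic_of_pos_smul fun w => ⟨1, one_pos, by simp⟩
  · refine ⟨Complex.conjCLE, m, hf.trans ?_⟩
    refine homotopic_of_pos_smul fun w => ⟨Complex.normSq w ^ m,
      pow_pos (Complex.normSq_pos.2 w.2) m, ?_⟩
    have := w.2
    simp [Complex.normSq_eq_conj_mul_self, mul_pow, mul_assoc, mul_inv_cancel₀ (pow_ne_zero m this)]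

/-- The suspension in coordinates of a power map. -/
noncomputable def powMap (σ : ℂ ≃L[ℝ] ℂ) (m : ℕ) (n : ℕ) :
    C(Punctured (ℂ × (Fin n → ℝ)), Punctured (ℂ × (Fin n → ℝ))) :=
  restrict (fun p => (σ p.1 ^ m, p.2)) (by fun_prop) (by
    rintro ⟨z, w⟩ hp h0
    simp only [Prod.mk_eq_zero, pow_eq_zero_iff', map_eq_zero_iff _ σ.injective] at h0
    exact hp (by simp [h0]))

/-- The isomorphism of nonzero vectors induced by a linear equivalence. -/
def congr {E F : Type*} [NormedAddCommGroup E] [NormedSpace ℝ E] [NormedAddCommGroup F]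
    [NormedSpace ℝ F] (e : E ≃L[ℝ] F) : Punctured E ≃ₜ Punctured F where
  toFun := restrict e e.continuous fun x hx => by simpa using hx
  invFun := restrict e.symm e.symm.continuous fun x hx => by simpa using hx
  left_inv x := Subtype.ext (by simp)
  right_inv x := Subtype.ext (by simp)
  continuous_toFun := ContinuousMap.continuous _
  continuous_invFun := ContinuousMap.continuous _

theorem homotopic_of_conj {X Y : Type*} [TopologicalSpace X] [TopologicalSpace Y] (e : X ≃ₜ Y)
    {f : C(X, X)} {g : C(Y, Y)}
    (h : ((e : C(X, Y)).comp (f.comp (e.symm : C(Y, X)))).Homotopic g) :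
    f.Homotopic ((e.symm : C(Y, X)).comp (g.comp (e : C(X, Y)))) := by
  have h1 := ((Homotopic.refl (e.symm : C(Y, X))).comp h).comp (Homotopic.refl (e : C(X, Y)))
  convert! h1 using 1
  ext x
  simp

/-- Every self-map of the nonzero vectors is homotopic to a suspended power map. -/
theorem exists_homotopic_powMap (n : ℕ)
    (f : C(Punctured (ℂ × (Fin n → ℝ)), Punctured (ℂ × (Fin n → ℝ)))) :
    ∃ σ m, f.Homotopic (powMap σ m n) := by
  induction n with
  | zero =>
    let e : (ℂ × (Fin 0 → ℝ)) ≃L[ℝ] ℂ := ContinuousLinearEquiv.prodUnique ℝ ℂ (Fin 0 → ℝ)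
    obtain ⟨σ, m, h⟩ := exists_homotopic_pow
      ((congr e : C(_, _)).comp (f.comp ((congr e).symm : C(_, _))))
    refine ⟨σ, m, ?_⟩
    convert! homotopic_of_conj _ h using 1
    refine ContinuousMap.ext fun x => Subtype.ext (Prod.ext ?_ (funext fun i => i.elim0))
    simp [powMap, congr, e]
  | succ n ih =>
    let e : (ℂ × (Fin (n + 1) → ℝ)) ≃L[ℝ] (ℂ × (Fin n → ℝ)) × ℝ :=
      { toFun := fun p => ((p.1, fun i => p.2 i.succ), p.2 0)
        invFun := fun q => (q.1.1, Fin.cons q.2 q.1.2)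
        map_add' := fun _ _ => rfl
        map_smul' := fun _ _ => rfl
        left_inv := fun p => Prod.ext rfl (Fin.cons_self_tail p.2)
        right_inv := fun q => rfl
        continuous_toFun := by fun_prop
        continuous_invFun := by fun_prop }
    obtain ⟨f1, hf1, hpos, hneg⟩ := exists_homotopic_avoiding (V := ℂ × (Fin n → ℝ)) (by simp)
      ((congr e : C(_, _)).comp (f.comp ((congr e).symm : C(_, _))))
    obtain ⟨h, hh⟩ := homotopic_suspend hpos hneg
    obtain ⟨σ, m, hσ⟩ := ih h
    refine ⟨σ, m, ?_⟩
    convert! homotopic_of_conj _ (hf1.trans (hh _ _ _ hσ)) using 1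
    exact ContinuousMap.ext fun x =>
      Subtype.ext (Prod.ext rfl (Fin.cons_self_tail x.1.2).symm)

section Jacobian

open MeasureTheory

variable {ι : Type*} [Fintype ι] [DecidableEq ι]

/-- The antisymmetrization of an expression containing a symmetric second derivative vanishes. -/
theorem sum_sign_mul_eq_zero {i₀ j : ι} (hj : j ≠ i₀) (H : ι → ι → ℝ) (hH : ∀ a b, H a b = H b a)
    (D : ι → ι → ℝ) :
    ∑ σ : Equiv.Perm ι, ((Equiv.Perm.sign σ : ℤ) : ℝ) *
      ((∏ i ∈ (Finset.univ.erase i₀).erase j, D i (σ i)) * H (σ j) (σ i₀)) = 0 := by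
  refine Finset.sum_involution (fun σ _ => σ * Equiv.swap i₀ j) (fun σ _ => ?_) (fun σ _ _ h => ?_)
    (fun _ _ => Finset.mem_univ _) (fun σ _ => by simp [mul_assoc])
  · have h1 : ∏ i ∈ (Finset.univ.erase i₀).erase j, D i ((σ * Equiv.swap i₀ j) i) =
        ∏ i ∈ (Finset.univ.erase i₀).erase j, D i (σ i) := by
      refine Finset.prod_congr rfl fun i hi => ?_
      simp only [Finset.mem_erase, Finset.mem_univ, and_true] at hi
      rw [Equiv.Perm.mul_apply, Equiv.swap_apply_of_ne_of_ne hi.2 hi.1]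
    rw [h1]
    simp only [Equiv.Perm.mul_apply, Equiv.swap_apply_left, Equiv.swap_apply_right,
      Equiv.Perm.sign_mul, Equiv.Perm.sign_swap hj.symm, hH (σ i₀) (σ j)]
    push_cast
    ring
  · have h2 : Equiv.swap i₀ j = 1 := by simpa using h
    exact hj (Equiv.swap_eq_one_iff.1 h2).symm

theorem det_fderiv_eq_sum {G : (ι → ℝ) → ι → ℝ} {x : ι → ℝ} (hG : DifferentiableAt ℝ G x) :
    (fderiv ℝ G x).det = ∑ σ : Equiv.Perm ι, ((Equiv.Perm.sign σ : ℤ) : ℝ) *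
      ∏ i, fderiv ℝ (fun y => G y i) x (Pi.single (σ i) 1) := by
  rw [ContinuousLinearMap.det, ← LinearMap.det_toMatrix', ← Matrix.det_transpose,
    Matrix.det_apply']
  refine Finset.sum_congr rfl fun σ _ => ?_
  congr 1
  refine Finset.prod_congr rfl fun i _ => ?_
  rw [Matrix.transpose_apply, LinearMap.toMatrix'_apply]
  have h := (hasFDerivAt_pi'.1 hG.hasFDerivAt i).fderiv
  rw [h]
  rfl

theorem integral_det_fderiv_eq_zero {G : (ι → ℝ) → ι → ℝ} (hG : ContDiff ℝ ∞ G) (i₀ : ι)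
    (hc : HasCompactSupport fun x => G x i₀) : ∫ x, (fderiv ℝ G x).det = 0 := by
  let D : ι → ι → (ι → ℝ) → ℝ := fun i a x => fderiv ℝ (fun y => G y i) x (Pi.single a 1)
  have hGi : ∀ i, ContDiff ℝ ∞ fun y => G y i := fun i => contDiff_pi.1 hG i
  have hD : ∀ i a, ContDiff ℝ ∞ (D i a) := fun i a =>
    ((hGi i).fderiv_right (m := ∞) (by simp)).clm_apply contDiff_const
  have hDd : ∀ i a x, DifferentiableAt ℝ (D i a) x := fun i a x =>
    (hD i a).contDiffAt.differentiableAt (by simp)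
  have hsymm : ∀ i a b x, fderiv ℝ (D i a) x (Pi.single b 1) =
      fderiv ℝ (D i b) x (Pi.single a 1) := by
    intro i a b x
    have h1 : ∀ c : ι, fderiv ℝ (D i c) x =
        (fderiv ℝ (fderiv ℝ fun y => G y i) x).flip (Pi.single c 1) := fun c => by
      have := ((hGi i).fderiv_right (m := ∞) (by simp)).contDiffAt.differentiableAt (x := x)
        (by simp)
      simp only [D]
      rw [fderiv_clm_apply this (differentiableAt_const _)]
      simp
    rw [h1, h1]
    exact (hGi i).contDiffAt.isSymmSndFDerivAt (by
      rw [minSmoothness_of_isRCLikeNormedField]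
      exact WithTop.coe_le_coe.2 (le_top (a := (2 : ℕ∞)))) _ _
  let P : Equiv.Perm ι → (ι → ℝ) → ℝ := fun σ x => ∏ i ∈ Finset.univ.erase i₀, D i (σ i) x
  have hP : ∀ σ, ContDiff ℝ ∞ (P σ) := fun σ => contDiff_prod fun i _ => hD i (σ i)
  have hPsum : ∀ x, ∑ σ : Equiv.Perm ι, ((Equiv.Perm.sign σ : ℤ) : ℝ) *
      fderiv ℝ (P σ) x (Pi.single (σ i₀) 1) = 0 := by
    intro x
    have h1 : ∀ σ : Equiv.Perm ι, fderiv ℝ (P σ) x (Pi.single (σ i₀) 1) =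
        ∑ j ∈ Finset.univ.erase i₀, (∏ i ∈ (Finset.univ.erase i₀).erase j, D i (σ i) x) *
          fderiv ℝ (D j (σ j)) x (Pi.single (σ i₀) 1) := fun σ => by
      simp only [P]
      rw [fderiv_finsetProd fun i _ => hDd i (σ i) x]
      simp
    simp only [h1, Finset.mul_sum]
    rw [Finset.sum_comm]
    refine Finset.sum_eq_zero fun j hj => ?_
    exact sum_sign_mul_eq_zero (Finset.ne_of_mem_erase hj)
      (fun a b => fderiv ℝ (D j a) x (Pi.single b 1)) (fun a b => hsymm j a b x)
      (fun i a => D i a x)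
  have hcD : ∀ a, HasCompactSupport (D i₀ a) := fun a => hc.fderiv_apply ℝ _
  have hint1 : ∀ σ : Equiv.Perm ι, Integrable fun x => D i₀ (σ i₀) x * P σ x := fun σ =>
    ((hD _ _).continuous.mul (hP σ).continuous).integrable_of_hasCompactSupport
      ((hcD _).mul_right)
  have hcP : ∀ σ a, Continuous fun x => fderiv ℝ (P σ) x (Pi.single a 1) := fun σ a =>
    ((hP σ).continuous_fderiv (by simp)).clm_apply continuous_const
  have hint2 : ∀ σ : Equiv.Perm ι, Integrable fun x =>
      G x i₀ * fderiv ℝ (P σ) x (Pi.single (σ i₀) 1) := fun σ =>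
    ((hGi i₀).continuous.mul (hcP σ _)).integrable_of_hasCompactSupport hc.mul_right
  have hibp : ∀ σ : Equiv.Perm ι, ∫ x, D i₀ (σ i₀) x * P σ x =
      -∫ x, G x i₀ * fderiv ℝ (P σ) x (Pi.single (σ i₀) 1) := fun σ => by
    rw [integral_mul_fderiv_eq_neg_fderiv_mul_of_integrable (hint1 σ) (hint2 σ)
      (((hGi i₀).continuous.mul (hP σ).continuous).integrable_of_hasCompactSupport hc.mul_right)
      (fun x _ => (hGi i₀).contDiffAt.differentiableAt (by simp))
      (fun x _ => (hP σ).contDiffAt.differentiableAt (by simp)), neg_neg]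
  have hdet : ∀ x, (fderiv ℝ G x).det = ∑ σ : Equiv.Perm ι, ((Equiv.Perm.sign σ : ℤ) : ℝ) *
      (D i₀ (σ i₀) x * P σ x) := fun x => by
    rw [det_fderiv_eq_sum (hG.contDiffAt.differentiableAt (by simp))]
    refine Finset.sum_congr rfl fun σ _ => ?_
    rw [← Finset.mul_prod_erase _ _ (Finset.mem_univ i₀)]
  simp only [hdet]
  rw [integral_finsetSum _ fun σ _ => (hint1 σ).const_mul _]
  simp only [integral_const_mul, hibp, mul_neg]
  rw [Finset.sum_neg_distrib, neg_eq_zero]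
  simp only [← integral_const_mul]
  rw [← integral_finsetSum _ fun σ _ => (hint2 σ).const_mul _]
  simp only [mul_left_comm _ (G _ i₀), ← Finset.mul_sum, hPsum, mul_zero, integral_zero]

end Jacobian

section Degree

open MeasureTheory

variable {W : Type*} [NormedAddCommGroup W] [NormedSpace ℝ W] [FiniteDimensional ℝ W]

theorem det_of_transvection (A : ℝ × W →L[ℝ] ℝ × W) (c : ℝ) (l : W →L[ℝ] ℝ)
    (h : ∀ p, (A p).1 = c * p.1 + l (A p).2) :
    A.det = c * (((ContinuousLinearMap.snd ℝ ℝ W).comp A).comp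
      (ContinuousLinearMap.inr ℝ ℝ W)).det := by
  set M := ((ContinuousLinearMap.snd ℝ ℝ W).comp A).comp (ContinuousLinearMap.inr ℝ ℝ W) with hM
  let T1 := LinearMap.transvection ((l : W →ₗ[ℝ] ℝ).comp (LinearMap.snd ℝ ℝ W)) ((1 : ℝ), (0 : W))
  let T2 := LinearMap.transvection (LinearMap.fst ℝ ℝ W) ((0 : ℝ), (A (1, 0)).2)
  have hA : (A : ℝ × W →ₗ[ℝ] ℝ × W) =
      T1 * (LinearMap.prodMap (c • LinearMap.id) LinearMap.id *
        (T2 * LinearMap.prodMap LinearMap.id (M : W →ₗ[ℝ] W))) := by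
    refine LinearMap.ext fun p => ?_
    have h1 : (A p).2 = M p.2 + p.1 • (A (1, 0)).2 := by
      have : p = (0, p.2) + p.1 • ((1 : ℝ), (0 : W)) := Prod.ext (by simp) (by simp)
      conv_lhs => rw [this, map_add, map_smul]
      rfl
    refine Prod.ext ?_ ?_
    · simp [T1, T2, LinearMap.transvection.apply, h p, h1]
    · simp [T1, T2, LinearMap.transvection.apply, h1]
  have h1 : LinearMap.det T1 = 1 := by
    simp [T1, LinearMap.transvection.det]
  have h2 : LinearMap.det T2 = 1 := by
    simp [T2, LinearMap.transvection.det]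
  rw [ContinuousLinearMap.det, hA, map_mul, map_mul, map_mul, h1, h2, LinearMap.det_prodMap,
    LinearMap.det_prodMap]
  simp [ContinuousLinearMap.det]

theorem det_fderiv_eq_zero {G : ℝ × W → ℝ × W} (hG : ContDiff ℝ ∞ G)
    (hc : HasCompactSupport fun x => (G x).1) (hpos : ∀ x, 0 ≤ (fderiv ℝ G x).det)
    (x : ℝ × W) : (fderiv ℝ G x).det = 0 := by
  let e' : W ≃L[ℝ] (Fin (Module.finrank ℝ W) → ℝ) :=
    ContinuousLinearEquiv.ofFinrankEq (by simp)
  let e : (ℝ × W) ≃L[ℝ] (Fin (Module.finrank ℝ W + 1) → ℝ) :=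
    ((ContinuousLinearEquiv.refl ℝ ℝ).prodCongr e').trans
      (Fin.consEquivL ℝ fun _ : Fin (Module.finrank ℝ W + 1) => ℝ)
  have he : ∀ p, e p 0 = p.1 := fun p => rfl
  have hd : ∀ x, HasFDerivAt G (fderiv ℝ G x) x := fun x =>
    (hG.contDiffAt.differentiableAt (by simp)).hasFDerivAt
  have hdet : ∀ y, (fderiv ℝ (fun y => e (G (e.symm y))) y).det =
      (fderiv ℝ G (e.symm y)).det := by
    intro y
    have h1 := (e.hasFDerivAt (x := G (e.symm y))).comp y
      ((hd (e.symm y)).comp y e.symm.hasFDerivAt)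
    have h2 : fderiv ℝ (fun y => e (G (e.symm y))) y = _ := h1.fderiv
    rw [h2]
    exact LinearMap.det_conj (fderiv ℝ G (e.symm y) : (ℝ × W) →ₗ[ℝ] ℝ × W) e.toLinearEquiv
  have h0 : ∫ y, (fderiv ℝ G (e.symm y)).det = 0 := by
    simp only [← hdet]
    refine integral_det_fderiv_eq_zero (by fun_prop) 0 ?_
    simp only [he]
    exact hc.comp_homeomorph e.symm.toHomeomorph
  by_contra hx
  have hcont : Continuous fun y => (fderiv ℝ G y).det :=
    ContinuousLinearMap.continuous_det.comp (hG.continuous_fderiv (by simp))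
  have hsupp : HasCompactSupport fun y => (fderiv ℝ G y).det := by
    refine HasCompactSupport.intro hc fun y hy => ?_
    by_contra h1
    let A := (fderiv ℝ G y).toContinuousLinearEquivOfDetNeZero h1
    have h2 : fderiv ℝ (fun x => (G x).1) y = (ContinuousLinearMap.fst ℝ ℝ W).comp
      (fderiv ℝ G y) := (hd y).fst.fderiv
    have h3 : fderiv ℝ (fun x => (G x).1) y = 0 :=
      image_eq_zero_of_notMem_tsupport fun h => hy (tsupport_fderiv_subset ℝ h)
    have h4 : (A (A.symm (1, 0))).1 = (0 : ℝ) := by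
      have := DFunLike.congr_fun (h2.symm.trans h3) (A.symm (1, 0))
      exact this
    rw [A.apply_symm_apply] at h4
    exact one_ne_zero h4
  have := Continuous.integral_pos_of_hasCompactSupport_nonneg_nonzero (μ := volume)
    (f := fun y => (fderiv ℝ G (e.symm y)).det) (x := e x) (hcont.comp e.symm.continuous)
    (hsupp.comp_homeomorph e.symm.toHomeomorph) (fun y => hpos _) (by simpa using hx)
  exact this.ne' h0

end Degree

section Obstruction

variable {W : Type*} [NormedAddCommGroup W] [NormedSpace ℝ W] [FiniteDimensional ℝ W]

theorem exists_plateau : ∃ χ : ℝ → ℝ, ContDiff ℝ ∞ χ ∧ (∀ s ∉ Icc (-2 : ℝ) 3, χ s = 0) ∧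
    (∀ s < 2, 0 ≤ deriv χ s) ∧ (∀ s, -1 < s → deriv χ s ≤ 0) ∧ ∃ s < -1, deriv χ s ≠ 0 := by
  let χ : ℝ → ℝ := fun s => (s + 2).smoothTransition * (3 - s).smoothTransition
  have hχ : ContDiff ℝ ∞ χ :=
    (Real.smoothTransition.contDiff.comp (by fun_prop)).mul
      (Real.smoothTransition.contDiff.comp (by fun_prop))
  have hl : ∀ s ≤ 2, χ s = (s + 2).smoothTransition := fun s hs => by
    simp [χ, Real.smoothTransition.one_of_one_le (show 1 ≤ 3 - s by linarith)]
  have hr : ∀ s, -1 ≤ s → χ s = (3 - s).smoothTransition := fun s hs => by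
    simp [χ, Real.smoothTransition.one_of_one_le (show 1 ≤ s + 2 by linarith)]
  refine ⟨χ, hχ, fun s hs => ?_, fun s hs => ?_, fun s hs => ?_, ?_⟩
  · by_cases h : s ≤ -2
    · simp [χ, Real.smoothTransition.zero_of_nonpos (show s + 2 ≤ 0 by linarith)]
    · have : 3 < s := by
        by_contra h3
        exact hs ⟨by linarith, by linarith⟩
      simp [χ, Real.smoothTransition.zero_of_nonpos (show 3 - s ≤ 0 by linarith)]
  · have h1 : χ =ᶠ[𝓝 s] fun s => (s + 2).smoothTransition := by
      filter_upwards [Iio_mem_nhds hs] with t ht using hl t (le_of_lt ht)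
    rw [h1.deriv_eq]
    exact Monotone.deriv_nonneg fun a b hab => Real.smoothTransition.monotone (by linarith)
  · have h1 : χ =ᶠ[𝓝 s] fun s => (3 - s).smoothTransition := by
      filter_upwards [Ioi_mem_nhds hs] with t ht using hr t (le_of_lt ht)
    rw [h1.deriv_eq]
    exact Antitone.deriv_nonpos fun a b hab => Real.smoothTransition.monotone (by linarith)
  · obtain ⟨s, hs, hs'⟩ := exists_deriv_eq_slope χ (show (-2 : ℝ) < -1 by norm_num)
      hχ.continuous.continuousOn (hχ.differentiable (by simp)).differentiableOn
    refine ⟨s, hs.2, ?_⟩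
    rw [hs', hl _ (by norm_num), hl _ (by norm_num)]
    norm_num [Real.smoothTransition.zero_of_nonpos, Real.smoothTransition.one_of_one_le]

theorem not_smooth_homotopy_neg (hodd : Odd (Module.finrank ℝ W)) {ψ : W → W}
    (hdet : ∀ x, 0 ≤ (fderiv ℝ ψ x).det)
    {x₀ : W} (hx₀ : ‖ψ x₀‖ < 1 / 2) (hdet₀ : (fderiv ℝ ψ x₀).det ≠ 0)
    {F : ℝ × W → W} (hF : ContDiff ℝ ∞ F) (hl : ∀ s < -1 / 2, ∀ x, F (s, x) = ψ x)
    (hr : ∀ s, 3 / 2 < s → ∀ x, F (s, x) = -ψ x) (hn : ∀ s x, 1 ≤ ‖x‖ → 1 / 2 ≤ ‖F (s, x)‖) :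
    False := by
  obtain ⟨χ, hχ, hχ0, hχpos, hχneg, s₀, hs₀, hχs₀⟩ := exists_plateau
  let φ : ContDiffBump (0 : W) := ⟨1 / 4, 1 / 2, by norm_num, by norm_num⟩
  have hφ : ContDiff ℝ ∞ φ := φ.contDiff
  let G : ℝ × W → ℝ × W := fun p => (χ p.1 * φ (F p), F p)
  have hG : ContDiff ℝ ∞ G :=
    ((hχ.comp contDiff_fst).mul (hφ.comp hF)).prodMk hF
  have hsupp : HasCompactSupport fun p => (G p).1 := by
    refine HasCompactSupport.intro (isCompact_Icc.prod (isCompact_closedBall (0 : W) 1))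
      (K := Icc (-2 : ℝ) 3 ×ˢ Metric.closedBall (0 : W) 1) fun p hp => ?_
    simp only [G]
    by_cases h : p.1 ∈ Icc (-2 : ℝ) 3
    · have h1 : 1 ≤ ‖p.2‖ := by
        by_contra h1
        exact hp ⟨h, by simpa using (not_le.1 h1).le⟩
      have := φ.zero_of_le_dist (x := F p) (by simpa [φ] using hn p.1 p.2 h1)
      simp [this]
    · simp [hχ0 _ h]
  let D : ℝ → W → W →L[ℝ] W := fun s x => fderiv ℝ (fun y => F (s, y)) x
  have hFd : ∀ p, HasFDerivAt F (fderiv ℝ F p) p := fun p =>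
    (hF.contDiffAt.differentiableAt (by simp)).hasFDerivAt
  have hdetG : ∀ p, (fderiv ℝ G p).det = deriv χ p.1 * φ (F p) * (D p.1 p.2).det := by
    intro p
    have h1 : HasFDerivAt (fun q : ℝ × W => χ q.1)
        (deriv χ p.1 • ContinuousLinearMap.fst ℝ ℝ W) p :=
      ((hχ.differentiable (by simp) p.1).hasDerivAt).comp_hasFDerivAt p hasFDerivAt_fst
    have h2 : HasFDerivAt (fun q => φ (F q)) ((fderiv ℝ φ (F p)).comp (fderiv ℝ F p)) p :=
      ((hφ.differentiable (by simp)) (F p)).hasFDerivAt.comp p (hFd p)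
    have h3 : HasFDerivAt G _ p := (h1.mul h2).prodMk (hFd p)
    rw [h3.fderiv, det_of_transvection _ (deriv χ p.1 * φ (F p)) (χ p.1 • fderiv ℝ φ (F p))]
    · have h4 : HasFDerivAt (fun y => F (p.1, y))
          ((fderiv ℝ F p).comp (ContinuousLinearMap.inr ℝ ℝ W)) p.2 :=
        HasFDerivAt.comp (g := F) p.2 (hFd (p.1, p.2)) (hasFDerivAt_prodMk_right p.1 p.2)
      simp only [D, h4.fderiv]
      rfl
    · intro q
      simp
      ring
  have hDl : ∀ s < -1 / 2, ∀ x, D s x = fderiv ℝ ψ x := fun s hs x => by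
    simp only [D, funext (hl s hs)]
  have hDr : ∀ s, 3 / 2 < s → ∀ x, (D s x).det = -(fderiv ℝ ψ x).det := fun s hs x => by
    simp only [D, funext (hr s hs), fderiv_fun_neg]
    have h1 : ((-fderiv ℝ ψ x : W →L[ℝ] W) : W →ₗ[ℝ] W)
        = (-1 : ℝ) • (fderiv ℝ ψ x : W →ₗ[ℝ] W) := by ext; simp
    rw [ContinuousLinearMap.det, h1, LinearMap.det_smul, hodd.neg_one_pow, neg_one_mul,
      ContinuousLinearMap.det]
  have hG0 := det_fderiv_eq_zero hG hsupp (fun p => by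
    rw [hdetG]
    rcases le_or_gt p.1 (-1) with h | h
    · rw [hDl _ (by linarith)]
      exact mul_nonneg (mul_nonneg (hχpos _ (by linarith)) φ.nonneg) (hdet _)
    · rcases lt_or_ge p.1 2 with h2 | h2
      · simp [le_antisymm (hχneg _ h) (hχpos _ h2)]
      · rw [hDr _ (by linarith)]
        have := mul_nonneg (mul_nonneg (neg_nonneg.2 (hχneg _ h)) (φ.nonneg (x := F p)))
          (hdet p.2)
        linarith) (s₀, x₀)
  rw [hdetG] at hG0
  simp only at hG0
  rw [hDl _ (by linarith), hl _ (by linarith)] at hG0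
  refine mul_ne_zero (mul_ne_zero hχs₀ ?_) hdet₀ hG0
  exact (φ.pos_of_mem_ball (by simpa [φ] using hx₀)).ne'

/-- A map which preserves orientation, somewhere strictly near the origin, is not homotopic to its
negative on the nonzero vectors of an odd-dimensional space. -/
theorem not_homotopic_neg (hodd : Odd (Module.finrank ℝ W)) {ψ : W → W}
    (hψ : ContDiff ℝ ∞ ψ) (hψ0 : ∀ x, x ≠ 0 → ψ x ≠ 0) (hψ1 : ∀ x, 1 ≤ ‖x‖ → 1 ≤ ‖ψ x‖)
    (hdet : ∀ x, 0 ≤ (fderiv ℝ ψ x).det)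
    {x₀ : W} (hx₀ : ‖ψ x₀‖ < 1 / 2) (hdet₀ : (fderiv ℝ ψ x₀).det ≠ 0) :
    ¬ (restrict ψ hψ.continuous hψ0).Homotopic
      (restrict (fun x => -ψ x) hψ.continuous.neg fun x hx => neg_ne_zero.2 (hψ0 x hx)) := by
  rintro ⟨K⟩
  have hψc := hψ.continuous
  let a : ℝ → ℝ := fun s => max 0 (min 1 (1 - 3 * s))
  let b : ℝ → ℝ := fun s => max 0 (min 1 (3 * s - 2))
  let k : ℝ → W → W := fun s x =>
    normPreserving K.toContinuousMap (projIcc 0 1 zero_le_one (3 * s - 1)) x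
  have hk : Continuous fun p : ℝ × W => k p.1 p.2 := by
    have h1 : Continuous fun p : ℝ × W =>
        ((projIcc 0 1 zero_le_one (3 * p.1 - 1) : unitInterval), p.2) :=
      (continuous_projIcc.comp (by fun_prop)).prodMk continuous_snd
    exact (continuous_normPreserving K.toContinuousMap).comp h1
  let F₀ : ℝ × W → W := fun p => (a p.1 - b p.1) • ψ p.2 + (1 - a p.1 - b p.1) • k p.1 p.2
  have hF₀ : Continuous F₀ := by
    unfold F₀ a b
    fun_prop
  have hF₀l : ∀ s ≤ 0, ∀ x, F₀ (s, x) = ψ x := fun s hs x => by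
    have ha : a s = 1 := by
      simp only [a]; rw [min_eq_left (by linarith)]; simp
    have hb : b s = 0 := by
      simp only [b]; rw [min_eq_right (by linarith), max_eq_left (by linarith)]
    simp [F₀, ha, hb]
  have hF₀r : ∀ s, 1 ≤ s → ∀ x, F₀ (s, x) = -ψ x := fun s hs x => by
    have ha : a s = 0 := by
      simp only [a]; rw [min_eq_right (by linarith), max_eq_left (by linarith)]
    have hb : b s = 1 := by
      simp only [b]; rw [min_eq_left (by linarith)]; simp
    simp [F₀, ha, hb]
  have hF₀n : ∀ s x, 1 ≤ ‖x‖ → 1 ≤ ‖F₀ (s, x)‖ := by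
    intro s x hx
    have hx0 : x ≠ 0 := norm_pos_iff.1 (by linarith)
    have hpos : 0 < ‖ψ x‖ := norm_pos_iff.2 (hψ0 x hx0)
    have key : ∀ t ∈ Icc (0 : ℝ) 1, 1 ≤ ‖t • ψ x + (1 - t) • (‖x‖ / ‖ψ x‖) • ψ x‖ := by
      intro t ht
      have h1 : t • ψ x + (1 - t) • (‖x‖ / ‖ψ x‖) • ψ x
          = (t + (1 - t) * (‖x‖ / ‖ψ x‖)) • ψ x := by module
      rw [h1, norm_smul, Real.norm_of_nonneg
        (add_nonneg ht.1 (mul_nonneg (sub_nonneg.2 ht.2) (by positivity))), add_mul, mul_assoc,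
        div_mul_cancel₀ _ hpos.ne']
      nlinarith [ht.1, ht.2, hψ1 x hx]
    rcases le_or_gt s (1 / 3) with h1 | h1
    · have hb : b s = 0 := by
        simp only [b]; rw [min_eq_right (by linarith), max_eq_left (by linarith)]
      have hks : k s x = (‖x‖ / ‖ψ x‖) • ψ x := by
        simp only [k]
        rw [projIcc_of_le_left _ (by linarith)]
        have h2 := normPreserving_of_ne K.toContinuousMap 0 ⟨x, hx0⟩
        have h3 : K.toContinuousMap (0, ⟨x, hx0⟩) = restrict ψ hψc hψ0 ⟨x, hx0⟩ :=
          K.map_zero_left _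
        rw [h3] at h2
        exact h2
      simp only [F₀, hb, hks, sub_zero]
      exact key _ ⟨le_max_left _ _, max_le zero_le_one (min_le_left _ _)⟩
    · have ha : a s = 0 := by
        simp only [a]; rw [min_eq_right (by linarith), max_eq_left (by linarith)]
      rcases le_or_gt s (2 / 3) with h2 | h2
      · have hb : b s = 0 := by
          simp only [b]; rw [min_eq_right (by linarith), max_eq_left (by linarith)]
        simpa [F₀, ha, hb, k] using hx
      · have hks : k s x = -((‖x‖ / ‖ψ x‖) • ψ x) := by
          simp only [k]
          rw [projIcc_of_right_le _ (by linarith)]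
          have h2 := normPreserving_of_ne K.toContinuousMap 1 ⟨x, hx0⟩
          have h3 : ((K.toContinuousMap (1, ⟨x, hx0⟩) : Punctured W) : W) = -ψ x :=
            congrArg Subtype.val (K.map_one_left ⟨x, hx0⟩)
          rw [h3] at h2
          simpa using h2
        have h3 : F₀ (s, x) = -(b s • ψ x + (1 - b s) • (‖x‖ / ‖ψ x‖) • ψ x) := by
          simp only [F₀, ha, hks]
          module
        rw [h3, norm_neg]
        exact key _ ⟨le_max_left _ _, max_le zero_le_one (min_le_left _ _)⟩
  have hU : IsOpen {p : ℝ × W | p.1 < 0 ∨ 1 < p.1} :=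
    (isOpen_lt continuous_fst continuous_const).union (isOpen_lt continuous_const continuous_fst)
  have hS : IsClosed {p : ℝ × W | p.1 ≤ -1 / 2 ∨ 3 / 2 ≤ p.1} :=
    (isClosed_le continuous_fst continuous_const).union
      (isClosed_le continuous_const continuous_fst)
  obtain ⟨F, hF, hFd, hFS, -⟩ := hF₀.exists_contDiff_approx_and_eqOn ⊤
    (ε := fun _ => 1 / 2) continuous_const (fun _ => by norm_num) hS
    (U := {p | p.1 < 0 ∨ 1 < p.1}) (hU.mem_nhdsSet.2 (by
      rintro p (hp | hp)
      · exact Or.inl (by linarith)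
      · exact Or.inr (by linarith))) (by
      intro p hp
      refine ContDiffAt.contDiffWithinAt ?_
      rcases hp with hp | hp
      · have h1 : F₀ =ᶠ[𝓝 p] fun q => ψ q.2 := by
          filter_upwards [(isOpen_lt continuous_fst continuous_const).mem_nhds hp] with q hq
          exact hF₀l q.1 (le_of_lt hq) q.2
        exact (hψ.comp contDiff_snd).contDiffAt.congr_of_eventuallyEq h1
      · have h1 : F₀ =ᶠ[𝓝 p] fun q => -ψ q.2 := by
          filter_upwards [(isOpen_lt continuous_const continuous_fst).mem_nhds hp] with q hq
          exact hF₀r q.1 (le_of_lt hq) q.2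
        exact (hψ.comp contDiff_snd).neg.contDiffAt.congr_of_eventuallyEq h1)
  refine not_smooth_homotopy_neg hodd hdet hx₀ hdet₀ hF
    (fun s hs x => ?_) (fun s hs x => ?_) fun s x hx => ?_
  · rw [hFS (Or.inl hs.le), hF₀l s (by linarith)]
  · rw [hFS (Or.inr hs.le), hF₀r s (by linarith)]
  · have h1 := hF₀n s x hx
    have h2 := hFd (s, x)
    rw [dist_comm, dist_eq_norm] at h2
    have h3 := norm_sub_norm_le (F₀ (s, x)) (F (s, x))
    linarith

end Obstruction

section Antipode

/-- The antipodal map on nonzero vectors. -/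
def antipode (E : Type*) [TopologicalSpace E] [AddGroup E] [IsTopologicalAddGroup E] :
    C(Punctured E, Punctured E) :=
  restrict (fun x => -x) continuous_neg fun _ hx => neg_ne_zero.2 hx

theorem hasFDerivAt_pow_prod (m n : ℕ) (p : ℂ × (Fin n → ℝ)) :
    HasFDerivAt (fun p : ℂ × (Fin n → ℝ) => (p.1 ^ m, p.2))
      ((((ContinuousLinearMap.toSpanSingleton ℂ ((m : ℂ) * p.1 ^ (m - 1))).restrictScalars
        ℝ).prodMap (ContinuousLinearMap.id ℝ (Fin n → ℝ)))) p := by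
  have h1 : HasFDerivAt (fun z : ℂ => z ^ m)
      ((ContinuousLinearMap.toSpanSingleton ℂ ((m : ℂ) * p.1 ^ (m - 1))).restrictScalars ℝ) p.1 :=
    (hasDerivAt_pow m p.1).hasFDerivAt.restrictScalars ℝ
  exact h1.prodMap p (hasFDerivAt_id p.2)

theorem det_fderiv_pow_prod (m n : ℕ) (p : ℂ × (Fin n → ℝ)) :
    (fderiv ℝ (fun p : ℂ × (Fin n → ℝ) => (p.1 ^ m, p.2)) p).det =
      Complex.normSq (m * p.1 ^ (m - 1)) := by
  rw [(hasFDerivAt_pow_prod m n p).fderiv, ← Algebra.norm_complex_apply, Algebra.norm_apply]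
  have h1 : ((ContinuousLinearMap.toSpanSingleton ℂ ((m : ℂ) * p.1 ^ (m - 1))).restrictScalars ℝ :
      ℂ →ₗ[ℝ] ℂ) = Algebra.lmul ℝ ℂ (m * p.1 ^ (m - 1)) := by
    ext z; simp [mul_comm]
  have h2 := LinearMap.det_prodMap (Algebra.lmul ℝ ℂ (m * p.1 ^ (m - 1)))
    (LinearMap.id (R := ℝ) (M := Fin n → ℝ))
  rw [LinearMap.det_id, mul_one, ← h1] at h2
  rw [← h1, ← h2]
  rfl

theorem powMap_not_homotopic_antipode (σ : ℂ ≃L[ℝ] ℂ) {m n : ℕ} (hm : m ≠ 0) (hn : Odd n) :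
    ¬ (powMap σ m n).Homotopic ((antipode _).comp (powMap σ m n)) := by
  intro h
  let e : (ℂ × (Fin n → ℝ)) ≃L[ℝ] (ℂ × (Fin n → ℝ)) :=
    σ.symm.prodCongr (ContinuousLinearEquiv.refl ℝ _)
  have h1 := h.comp (Homotopic.refl (congr e : C(Punctured (ℂ × (Fin n → ℝ)),
    Punctured (ℂ × (Fin n → ℝ)))))
  have hodd : Odd (Module.finrank ℝ (ℂ × (Fin n → ℝ))) := by
    rw [Module.finrank_prod, Complex.finrank_real_complex, Module.finrank_fin_fun]
    exact (even_two).add_odd hn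
  refine not_homotopic_neg hodd (ψ := fun p => (p.1 ^ m, p.2)) (by fun_prop) ?_ ?_ ?_
    (x₀ := (1 / 4, 0)) ?_ ?_ ?_
  · rintro ⟨z, w⟩ hp h0
    simp only [Prod.mk_eq_zero, pow_eq_zero_iff', ne_eq] at h0
    exact hp (by simp [h0])
  · rintro ⟨z, w⟩ h0
    simp only [Prod.norm_mk, le_sup_iff, norm_pow] at h0 ⊢
    exact h0.imp_left fun h => one_le_pow₀ h
  · intro p
    rw [det_fderiv_pow_prod]
    exact Complex.normSq_nonneg _
  · simp only [Prod.norm_mk, norm_pow, norm_zero]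
    have : ‖(1 / 4 : ℂ)‖ = 1 / 4 := by norm_num
    rw [this, max_eq_left (by positivity)]
    calc (1 / 4 : ℝ) ^ m ≤ (1 / 4) ^ 1 :=
          pow_le_pow_of_le_one (by norm_num) (by norm_num) (Nat.one_le_iff_ne_zero.2 hm)
      _ < 1 / 2 := by norm_num
  · rw [det_fderiv_pow_prod, Ne, Complex.normSq_eq_zero]
    exact mul_ne_zero (by exact_mod_cast hm) (by simp)
  · convert! h1 using 1
    · refine ContinuousMap.ext fun x => Subtype.ext ?_
      simp [powMap, e, congr]
    · refine ContinuousMap.ext fun x => Subtype.ext ?_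
      simp [powMap, e, congr, antipode]

/-- In odd dimension, a self-map of the nonzero vectors homotopic to its negative is
nullhomotopic. -/
theorem nullhomotopic_of_homotopic_antipode {V : Type*} [NormedAddCommGroup V] [NormedSpace ℝ V]
    [FiniteDimensional ℝ V] (hV : 2 ≤ Module.finrank ℝ V) (hodd : Odd (Module.finrank ℝ V))
    {f : C(Punctured V, Punctured V)} (hf : f.Homotopic ((antipode V).comp f)) :
    ∃ y, f.Homotopic (ContinuousMap.const _ y) := by
  obtain ⟨n, hn⟩ := Nat.exists_eq_add_of_le hV
  have hn' : Odd n := by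
    rw [hn] at hodd
    exact (Nat.odd_add'.1 hodd).2 even_two
  let e : V ≃L[ℝ] (ℂ × (Fin n → ℝ)) := ContinuousLinearEquiv.ofFinrankEq (by
    rw [Module.finrank_prod, Complex.finrank_real_complex, Module.finrank_fin_fun, hn])
  obtain ⟨σ, m, h⟩ := exists_homotopic_powMap n
    ((congr e : C(_, _)).comp (f.comp ((congr e).symm : C(_, _))))
  have hm : m = 0 := by
    by_contra hm
    refine powMap_not_homotopic_antipode σ hm hn' ?_
    have h1 := ((Homotopic.refl (congr e : C(Punctured V, Punctured (ℂ × (Fin n → ℝ))))).comp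
      hf).comp (Homotopic.refl ((congr e).symm : C(Punctured (ℂ × (Fin n → ℝ)), Punctured V)))
    have h2 := (Homotopic.refl (antipode (ℂ × (Fin n → ℝ)))).comp h
    refine h.symm.trans (Homotopic.trans ?_ h2)
    convert! h1 using 1
    refine ContinuousMap.ext fun x => Subtype.ext ?_
    simp [congr, antipode]
  subst hm
  have h3 : (powMap σ 0 n).Homotopic (ContinuousMap.const _ ⟨(1, 0), by simp⟩) :=
    homotopic_of_segment fun x s hs h0 => by
      have := congrArg Prod.fst h0
      simp [powMap] at this
  have h4 := homotopic_of_conj _ (h.trans h3)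
  exact ⟨(congr e).symm ⟨(1, 0), by simp⟩, h4⟩

end Antipode

section Lifting

variable {E : Type*} [NormedAddCommGroup E] [InnerProductSpace ℝ E]
  {Y X : Type*} [TopologicalSpace Y] [TopologicalSpace X] {p : Y → X}

theorem exists_continuousOn_lift (hp : IsCoveringMap p) (h : C(Metric.sphere (0 : E) 1, X))
    (v x₀ : Metric.sphere (0 : E) 1) (hx₀ : x₀ ≠ v) {y₀ : Y} (hy₀ : p y₀ = h x₀) :
    ∃ g : Metric.sphere (0 : E) 1 → Y, ContinuousOn g {v}ᶜ ∧ (∀ x ≠ v, p (g x) = h x) ∧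
      g x₀ = y₀ := by
  let e := stereographic (norm_eq_of_mem_sphere v)
  have hsymm : Continuous e.symm :=
    continuousOn_univ.1 (by simpa [e] using e.continuousOn_symm)
  have hinv : ∀ x ≠ v, e.symm (e x) = x := fun x hx => e.left_inv (by simpa [e] using hx)
  obtain ⟨L, ⟨hL0, hL⟩, -⟩ := hp.existsUnique_continuousMap_lifts
    (h.comp ⟨e.symm, hsymm⟩) (e x₀) y₀ (by simp [hinv x₀ hx₀, hy₀])
  refine ⟨fun x => L (e x), ?_, fun x hx => ?_, hL0⟩
  · exact L.continuous.comp_continuousOn (by simpa [e] using e.continuousOn)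
  · have := congrFun hL (e x)
    simpa [hinv x hx] using this

theorem isPreconnected_compl_pair [FiniteDimensional ℝ E] (hE : 2 < Module.finrank ℝ E)
    (v : Metric.sphere (0 : E) 1) : IsPreconnected ({v, -v}ᶜ : Set (Metric.sphere (0 : E) 1)) := by
  let e := stereographic (norm_eq_of_mem_sphere v)
  have hsymm : Continuous e.symm :=
    continuousOn_univ.1 (by simpa [e] using e.continuousOn_symm)
  have hrank : 1 < Module.rank ℝ (Submodule.span ℝ {(v : E)})ᗮ := by
    have h1 := Submodule.finrank_add_finrank_orthogonal (Submodule.span ℝ {(v : E)})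
    rw [finrank_span_singleton (ne_zero_of_mem_unit_sphere v)] at h1
    rw [← Module.finrank_eq_rank]
    exact_mod_cast (by omega : 1 < Module.finrank ℝ (Submodule.span ℝ {(v : E)})ᗮ)
  have h1 := (isConnected_compl_singleton_of_one_lt_rank hrank 0).isPreconnected.image e.symm
    hsymm.continuousOn
  convert! h1 using 1
  have he0 : e (-v) = 0 := stereographic_apply_neg v
  have hnv : -v ≠ v := fun h => ne_neg_of_mem_unit_sphere ℝ v h.symm
  ext x
  simp only [mem_compl_iff, mem_insert_iff, mem_singleton_iff, not_or, mem_image]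
  constructor
  · rintro ⟨h1, h2⟩
    refine ⟨e x, fun h0 => h2 ?_, e.left_inv (by simpa [e] using h1)⟩
    exact e.injOn (by simpa [e] using h1) (by simpa [e] using hnv) (h0.trans he0.symm)
  · rintro ⟨w, hw, rfl⟩
    have h3 : e.symm w ∈ e.source := e.map_target (by simp [e])
    refine ⟨by simpa [e] using h3, fun h4 => hw ?_⟩
    rw [← he0, ← h4, e.right_inv (by simp [e])]

/-- Maps from a sphere of dimension at least two lift through covering maps. -/
theorem exists_lift [FiniteDimensional ℝ E] (hE : 2 < Module.finrank ℝ E) (hp : IsCoveringMap p)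
    (hsurj : Function.Surjective p) (h : C(Metric.sphere (0 : E) 1, X)) :
    ∃ g : C(Metric.sphere (0 : E) 1, Y), ∀ x, p (g x) = h x := by
  have : Nontrivial E := Module.nontrivial_of_finrank_pos (R := ℝ) (by omega)
  obtain ⟨v⟩ : Nonempty (Metric.sphere (0 : E) 1) :=
    (NormedSpace.sphere_nonempty.2 zero_le_one).to_subtype
  have hnv : -v ≠ v := fun h => ne_neg_of_mem_unit_sphere ℝ v h.symm
  have hconn := isPreconnected_compl_pair hE v
  obtain ⟨x₀, hx₀⟩ : ({v, -v}ᶜ : Set (Metric.sphere (0 : E) 1)).Nonempty := by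
    have h1 : Infinite (Metric.sphere (0 : E) 1) := by
      refine Set.infinite_coe_iff.2 (IsPreconnected.infinite_of_nontrivial ?_ ?_)
      · refine isPreconnected_sphere ?_ _ _
        rw [← Module.finrank_eq_rank]
        exact_mod_cast (by omega : 1 < Module.finrank ℝ E)
      · exact ⟨v, v.2, (-v : Metric.sphere (0 : E) 1), (-v).2, fun h => hnv (Subtype.ext h.symm)⟩
    exact (Set.toFinite {v, -v}).infinite_compl.nonempty
  have hx₀' : x₀ ≠ v ∧ x₀ ≠ -v := by simpa using hx₀
  obtain ⟨y₀, hy₀⟩ := hsurj (h x₀)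
  obtain ⟨g, hg, hgl, hg0⟩ := exists_continuousOn_lift hp h v x₀ hx₀'.1 hy₀
  obtain ⟨k, hk, hkl, hk0⟩ := exists_continuousOn_lift hp h (-v) x₀ hx₀'.2 hy₀
  have heq : EqOn g k {v, -v}ᶜ := by
    refine hp.eqOn_of_comp_eqOn hconn (hg.mono (by simp)) (hk.mono (by simp)) (fun x hx => ?_) hx₀
      (hg0.trans hk0.symm)
    have hx' : x ≠ v ∧ x ≠ -v := by simpa using hx
    simp [hgl x hx'.1, hkl x hx'.2]
  classical
  let G : Metric.sphere (0 : E) 1 → Y := fun x => if x = v then k x else g x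
  have hGk : ∀ x ≠ -v, G x = k x := fun x hx => by
    by_cases hxv : x = v
    · simp [G, hxv]
    · simp only [G, if_neg hxv]
      exact heq (by simp [hx, hxv])
  have hGg : ∀ x ≠ v, G x = g x := fun x hx => by simp [G, hx]
  refine ⟨⟨G, continuous_iff_continuousAt.2 fun x => ?_⟩, fun x => ?_⟩
  · by_cases hxv : x = v
    · have hx : x ≠ -v := fun h => hnv (h.symm.trans hxv)
      refine ((hk x hx).continuousAt (isOpen_compl_singleton.mem_nhds hx)).congr ?_
      filter_upwards [isOpen_compl_singleton.mem_nhds hx] with z hz using (hGk z hz).symm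
    · refine ((hg x hxv).continuousAt (isOpen_compl_singleton.mem_nhds hxv)).congr ?_
      filter_upwards [isOpen_compl_singleton.mem_nhds hxv] with z hz using (hGg z hz).symm
  · by_cases hxv : x = v
    · have hx : x ≠ -v := fun h => hnv (h.symm.trans hxv)
      simpa [hGk x hx] using hkl x hx
    · simpa [hGg x hxv] using hgl x hxv

end Lifting

section Sphere

variable {E : Type*} [NormedAddCommGroup E] [InnerProductSpace ℝ E]

/-- The inclusion of the unit sphere in the nonzero vectors. -/
def ofSphere : C(Metric.sphere (0 : E) 1, Punctured E) where
  toFun x := ⟨x, ne_zero_of_mem_unit_sphere x⟩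

/-- The radial projection onto the unit sphere. -/
noncomputable def toSphere : C(Punctured E, Metric.sphere (0 : E) 1) where
  toFun x := ⟨‖(x : E)‖⁻¹ • (x : E), by
    simp [norm_smul, inv_mul_cancel₀ (norm_ne_zero_iff.2 x.2)]⟩
  continuous_toFun := by
    refine Continuous.subtype_mk (Continuous.smul (Continuous.inv₀ (by fun_prop) fun x => ?_)
      (by fun_prop)) _
    exact norm_ne_zero_iff.2 x.2

theorem toSphere_ofSphere (x : Metric.sphere (0 : E) 1) : toSphere (ofSphere x) = x :=
  Subtype.ext (by simp [toSphere, ofSphere])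

theorem homotopic_of_ne_neg {X : Type*} [TopologicalSpace X] {f g : C(X, Metric.sphere (0 : E) 1)}
    (h : ∀ x, (f x : E) ≠ -g x) : (ofSphere.comp f).Homotopic (ofSphere.comp g) := by
  refine homotopic_of_segment fun x s hs h0 => h x ?_
  simp only [ofSphere, ContinuousMap.comp_apply, ContinuousMap.coe_mk] at h0
  have h1 : (1 - s) • (f x : E) = -(s • (g x : E)) := eq_neg_of_add_eq_zero_left h0
  have h2 := congrArg norm h1
  simp only [norm_neg, norm_smul, norm_eq_of_mem_sphere, mul_one, Real.norm_eq_abs,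
    abs_of_nonneg hs.1, abs_of_nonneg (sub_nonneg.2 hs.2)] at h2
  have h3 : s = 1 / 2 := by linarith
  subst h3
  rw [← smul_neg, show (1 - 1 / 2 : ℝ) = 1 / 2 by norm_num] at h1
  exact smul_right_injective E (by norm_num : (1 / 2 : ℝ) ≠ 0) h1

theorem nullhomotopic_of_ne [FiniteDimensional ℝ E] (hE : 2 ≤ Module.finrank ℝ E)
    (hodd : Odd (Module.finrank ℝ E))
    {g₁ g₂ : C(Metric.sphere (0 : E) 1, Metric.sphere (0 : E) 1)}
    (h : ∀ x, g₁ x ≠ g₂ x) (h' : ∀ x, (g₁ x : E) ≠ -g₂ x) :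
    ∃ y, g₂.Homotopic (ContinuousMap.const _ y) := by
  have h1 := homotopic_of_ne_neg h'
  let g₃ : C(Metric.sphere (0 : E) 1, Metric.sphere (0 : E) 1) := ⟨fun x => -g₂ x, by fun_prop⟩
  have h2 : (ofSphere.comp g₁).Homotopic (ofSphere.comp g₃) :=
    homotopic_of_ne_neg fun x => by simpa [g₃, Subtype.ext_iff] using h x
  have h3 := (h1.symm.trans h2).comp (Homotopic.refl (toSphere (E := E)))
  obtain ⟨y, hy⟩ := nullhomotopic_of_homotopic_antipode hE hodd
    (f := (ofSphere.comp g₂).comp toSphere) (by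
      exact h3)
  refine ⟨toSphere y, ?_⟩
  have h4 := ((Homotopic.refl (toSphere (E := E))).comp hy).comp (Homotopic.refl ofSphere)
  convert! h4 using 1
  refine ContinuousMap.ext fun x => ?_
  simp [toSphere_ofSphere]

end Sphere

end Punctured

namespace RealProjectiveSpace

variable {n : ℕ}

/-- The quotient map from the sphere. -/
def mk (x : UnitSphere n) : RealProjectiveSpace n := Quot.mk _ x

theorem isQuotientMap_mk : Topology.IsQuotientMap (mk (n := n)) := isQuotientMap_quot_mk

theorem mk_neg (x : UnitSphere n) : mk (-x) = mk x :=
  (Quot.sound (r := fun x y : UnitSphere n =>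
    (y : EuclideanSpace ℝ (Fin (n + 1))) = -(x : EuclideanSpace ℝ (Fin (n + 1))))
    (coe_neg_sphere x)).symm

theorem mk_eq_mk_iff {x y : UnitSphere n} : mk x = mk y ↔ x = y ∨ x = -y := by
  constructor
  · intro h
    have h' := Quot.eqvGen_exact h
    clear h
    induction h' with
    | rel x y h => exact Or.inr (Subtype.ext (by simp [h]))
    | refl x => exact Or.inl rfl
    | symm x y _ ih => rcases ih with rfl | rfl <;> simp
    | trans x y z _ _ ih1 ih2 => rcases ih1 with rfl | rfl <;> rcases ih2 with rfl | rfl <;> simp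
  · rintro (rfl | rfl)
    · rfl
    · exact mk_neg y

theorem isCoveringMap_mk : IsCoveringMap (mk (n := n)) := by
  have hG : ∀ g : Metric.sphere (0 : ℝ) 1, g = 1 ∨ g = -1 := fun g => by
    have h1 : |(g : ℝ)| = 1 := norm_eq_of_mem_sphere g
    rcases eq_or_eq_neg_of_abs_eq h1 with h | h
    · exact Or.inl (Subtype.ext h)
    · exact Or.inr (Subtype.ext h)
  have hneg : ∀ x : UnitSphere n, (-1 : Metric.sphere (0 : ℝ) 1) • x = -x := fun x =>
    Subtype.ext (by change ((-1 : ℝ)) • (x : EuclideanSpace ℝ (Fin (n + 1))) = -x; simp)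
  have : IsQuotientCoveringMap (mk (n := n)) (Metric.sphere (0 : ℝ) 1) :=
    { isQuotientMap_mk with
      continuous_const_smul := fun g => by
        rcases hG g with rfl | rfl
        · simpa using continuous_id'
        · simpa [hneg] using continuous_neg
      apply_eq_iff_mem_orbit := by
        intro x y
        rw [mk_eq_mk_iff, MulAction.mem_orbit_iff]
        constructor
        · rintro (rfl | rfl)
          · exact ⟨1, one_smul _ _⟩
          · exact ⟨-1, hneg y⟩
        · rintro ⟨g, rfl⟩
          rcases hG g with rfl | rfl
          · simp
          · simp [hneg]
      disjoint := fun x => by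
        refine ⟨Metric.ball x 1, Metric.ball_mem_nhds _ one_pos, fun g hg => ?_⟩
        rcases hG g with rfl | rfl
        · rfl
        · exfalso
          obtain ⟨_, ⟨z, hz, rfl⟩, hz'⟩ := hg
          simp only [hneg, Metric.mem_ball, Subtype.dist_eq, dist_eq_norm] at hz hz'
          have h2 := norm_sub_le (((-z : UnitSphere n) : EuclideanSpace ℝ (Fin (n + 1))) - x)
            (-((z : EuclideanSpace ℝ (Fin (n + 1))) - x))
          have h3 : (((-z : UnitSphere n) : EuclideanSpace ℝ (Fin (n + 1))) - x)
              - -((z : EuclideanSpace ℝ (Fin (n + 1))) - x) = (-2 : ℝ) • (x : _) := by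
            simp only [coe_neg_sphere]
            module
          have h4 : ‖(-2 : ℝ)‖ = 2 := by norm_num
          rw [h3, norm_smul, h4, norm_eq_of_mem_sphere, norm_neg] at h2
          linarith }
  exact this.isCoveringMap

instance (n : ℕ) : PathConnectedSpace (RealProjectiveSpace (n + 1)) := by
  have h : PathConnectedSpace (UnitSphere (n + 1)) := by
    refine isPathConnected_iff_pathConnectedSpace.1 (isPathConnected_sphere ?_ _ zero_le_one)
    rw [← Module.finrank_eq_rank, finrank_euclideanSpace_fin]
    exact_mod_cast (by omega : 1 < n + 1 + 1)
  exact isQuotientMap_mk.surjective.pathConnectedSpace isQuotientMap_mk.continuous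

theorem exists_ne (n : ℕ) : ∃ y z : RealProjectiveSpace (n + 1), y ≠ z := by
  let x (i : Fin (n + 2)) : UnitSphere (n + 1) := ⟨EuclideanSpace.single i 1, by simp⟩
  refine ⟨mk (x 0), mk (x 1), fun h => ?_⟩
  rcases mk_eq_mk_iff.1 h with h | h
  · have := congrArg (fun v : UnitSphere (n + 1) => (v : EuclideanSpace ℝ (Fin (n + 2))) 0) h
    simp [x] at this
  · have := congrArg (fun v : UnitSphere (n + 1) => (v : EuclideanSpace ℝ (Fin (n + 2))) 0) h
    simp [x] at this

end RealProjectiveSpace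

/-- For `n ≥ 2` even and a continuous map `f : Sⁿ → ℝPⁿ`, the pair `(f, f)` is loose
if and only if `f` is nullhomotopic. -/
theorem statement12 (n : ℕ) (hn : 2 ≤ n) (hne : Even n)
    (f : C(UnitSphere n, RealProjectiveSpace n)) :
    Loose f f ↔ ∃ y : RealProjectiveSpace n, f.Homotopic (ContinuousMap.const _ y) := by
  constructor
  · rintro ⟨f₁, f₂, -, h₂, hne'⟩
    have hE : 2 < Module.finrank ℝ (EuclideanSpace ℝ (Fin (n + 1))) := by
      rw [finrank_euclideanSpace_fin]; omega
    obtain ⟨g₁, hg₁⟩ := Punctured.exists_lift hE RealProjectiveSpace.isCoveringMap_mk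
      RealProjectiveSpace.isQuotientMap_mk.surjective f₁
    obtain ⟨g₂, hg₂⟩ := Punctured.exists_lift hE RealProjectiveSpace.isCoveringMap_mk
      RealProjectiveSpace.isQuotientMap_mk.surjective f₂
    have hg : ∀ x, g₁ x ≠ g₂ x ∧ g₁ x ≠ -g₂ x := fun x => by
      rw [← not_or, ← RealProjectiveSpace.mk_eq_mk_iff, hg₁, hg₂]
      exact hne' x
    obtain ⟨y, hy⟩ := Punctured.nullhomotopic_of_ne hE.le
      (by rw [finrank_euclideanSpace_fin]; exact hne.add_one) (fun x => (hg x).1)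
      (fun x h => (hg x).2 (Subtype.ext h))
    let p : C(UnitSphere n, RealProjectiveSpace n) :=
      ⟨RealProjectiveSpace.mk, RealProjectiveSpace.isQuotientMap_mk.continuous⟩
    refine ⟨RealProjectiveSpace.mk y, h₂.symm.trans ?_⟩
    have h := (ContinuousMap.Homotopic.refl p).comp hy
    convert! h using 1
    exact ContinuousMap.ext fun x => (hg₂ x).symm
  · rintro ⟨y, hy⟩
    obtain ⟨m, rfl⟩ : ∃ m, n = m + 1 := ⟨n - 1, by omega⟩
    have : Nonempty (UnitSphere (m + 1)) :=
      (NormedSpace.sphere_nonempty.2 zero_le_one).to_subtype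
    have hconst : ∀ z, (ContinuousMap.const _ z).Homotopic f := fun z =>
      ((ContinuousMap.homotopic_const_iff).2 (PathConnectedSpace.joined z y)).trans hy.symm
    obtain ⟨z, w, hzw⟩ := RealProjectiveSpace.exists_ne m
    exact ⟨_, _, hconst z, hconst w, fun _ => hzw⟩
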